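/- arXiv:1310.8498 — 3 statements merged into one kernel-verified Lean document; each statement's English description precedes it below -/
import Mathlib

section
/- Let N ≥ 2 be an integer and let m_{2p} = ∫_ℝ x^{2p}·ρ_N(x) dx denote the even moments of the unscaled GOE eigenvalue density. Then m_0 = N, m_2 = N·(N+1), and for every integer p ≥ 4, (p+1)·m_{2p} = (4p−1)·(2N−1)·m_{2p−2} + (2p−3)·(10p² − 9p − 8N² + 8N)·m_{2p−4} − 5·(2p−3)·(2p−4)·(2p−5)·(2N−1)·m_{2p−6} − 2·(2p−3)·(2p−4)·(2p−5)·(2p−6)·(2p−7)·m_{2p−8}. -/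
open Nat MeasureTheory

/-- The orthonormal Hermite functions' polynomial part:
`p_n(x) = He_n(x)/√(√(2π)·n!)`, orthonormal for the weight `e^{-x²/2}` on `ℝ`. -/
noncomputable def pOrtho (n : ℕ) (x : ℝ) : ℝ :=
  Polynomial.aeval x (Polynomial.hermite n) /
    Real.sqrt (Real.sqrt (2 * Real.pi) * (n ! : ℝ))

/-- `q_n(x) = ∫_{−∞}^{x} e^{−t²/4} p_n(t) dt`. -/
noncomputable def qFun (n : ℕ) (x : ℝ) : ℝ :=
  ∫ t in Set.Iic x, Real.exp (-t ^ 2 / 4) * pOrtho n t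

/-- `D_n = π^{1/4} 2^{3/4} √((n−1)!!/n!!)`. -/
noncomputable def Dconst (n : ℕ) : ℝ :=
  Real.pi ^ ((1 : ℝ) / 4) * (2 : ℝ) ^ ((3 : ℝ) / 4) *
    Real.sqrt ((Nat.doubleFactorial (n - 1) : ℝ) / (Nat.doubleFactorial n : ℝ))

/-- `A_N = −(1/4)D_N` for even `N`, and `A_N = N^{−1/2} D_{N−1}^{−1}` for odd `N`. -/
noncomputable def Aconst (N : ℕ) : ℝ :=
  if N % 2 = 0 then -(1 / 4) * Dconst N else (Real.sqrt N)⁻¹ * (Dconst (N - 1))⁻¹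

/-- The (unscaled) GOE eigenvalue density
`ρ_N(x) = √N·(e^{−x²/2}(p_N'p_{N−1} − p_N p_{N−1}') + e^{−x²/4}((1/2)q_N + A_N)p_{N−1})`. -/
noncomputable def goeDensity (N : ℕ) (x : ℝ) : ℝ :=
  Real.sqrt N *
    (Real.exp (-x ^ 2 / 2) *
        (deriv (pOrtho N) x * pOrtho (N - 1) x - pOrtho N x * deriv (pOrtho (N - 1)) x) +
      Real.exp (-x ^ 2 / 4) * ((1 / 2) * qFun N x + Aconst N) * pOrtho (N - 1) x)

/-- The even moments `m_{2p} = ∫_ℝ x^{2p} ρ_N(x) dx` of the unscaled GOE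
eigenvalue density. -/
noncomputable def goeMoment (N p : ℕ) : ℝ :=
  ∫ x : ℝ, x ^ (2 * p) * goeDensity N x


/-- All power moments of `f` are absolutely convergent. -/
def HasMoments (f : ℝ → ℝ) : Prop :=
  ∀ k : ℕ, Integrable fun x : ℝ => x ^ k * f x

/-- The `k`-th power moment of `f`. -/
noncomputable def powerMoment (f : ℝ → ℝ) (k : ℕ) : ℝ :=
  ∫ x : ℝ, x ^ k * f x

namespace HasMoments

variable {f g : ℝ → ℝ}

theorem integrable (hf : HasMoments f) : Integrable f := by
  simpa using hf 0

theorem add (hf : HasMoments f) (hg : HasMoments g) : HasMoments fun x => f x + g x := by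
  intro k
  simp only [mul_add]
  exact (hf k).add (hg k)

theorem const_mul (hf : HasMoments f) (c : ℝ) : HasMoments fun x => c * f x := by
  intro k
  simpa only [mul_left_comm] using (hf k).const_mul c

theorem id_mul (hf : HasMoments f) : HasMoments fun x => x * f x := by
  intro k
  simpa only [pow_succ, mul_assoc] using hf (k + 1)

theorem bdd_mul (hf : HasMoments f) (hg : Continuous g) {C : ℝ} (hC : ∀ x, |g x| ≤ C) :
    HasMoments fun x => g x * f x := by
  intro k
  have := (hf k).bdd_mul hg.aestronglyMeasurable (c := C) (Filter.Eventually.of_forall hC)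
  simpa only [mul_left_comm] using this

theorem powerMoment_add (hf : HasMoments f) (hg : HasMoments g) (k : ℕ) :
    powerMoment (fun x => f x + g x) k = powerMoment f k + powerMoment g k := by
  simpa only [powerMoment, mul_add] using integral_add (hf k) (hg k)

end HasMoments

theorem powerMoment_const_mul (f : ℝ → ℝ) (c : ℝ) (k : ℕ) :
    powerMoment (fun x => c * f x) k = c * powerMoment f k := by
  simpa only [powerMoment, mul_left_comm] using
    integral_const_mul (μ := volume) c fun x : ℝ => x ^ k * f x

theorem powerMoment_id_mul (f : ℝ → ℝ) (k : ℕ) :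
    powerMoment (fun x => x * f x) k = powerMoment f (k + 1) := by
  simp only [powerMoment, pow_succ, mul_assoc]

/-- Integration by parts for power moments. -/
theorem HasMoments.powerMoment_deriv {f f' : ℝ → ℝ} (hf : HasMoments f) (hf' : HasMoments f')
    (hd : ∀ x, HasDerivAt f (f' x) x) (k : ℕ) :
    (k : ℝ) * powerMoment f (k - 1) + powerMoment f' k = 0 := by
  have h := integral_eq_zero_of_hasDerivAt_of_integrable
    (fun x => (hasDerivAt_pow k x).mul (hd x)) ?_ (hf k)
  · rw [powerMoment, powerMoment, ← integral_const_mul, ← integral_add _ (hf' k), ← h]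
    · simp only [mul_assoc]
    · exact (hf _).const_mul _
  · simp only [mul_assoc]
    exact ((hf (k - 1)).const_mul (k : ℝ)).add (hf' k)

theorem Polynomial.hasMoments_mul_exp (P : Polynomial ℝ) {b : ℝ} (hb : 0 < b) :
    HasMoments fun x => P.eval x * Real.exp (-b * x ^ 2) := by
  induction P using Polynomial.induction_on' with
  | add p q hp hq => simpa only [Polynomial.eval_add, add_mul] using hp.add hq
  | monomial n a =>
    intro k
    have hpos : (-1 : ℝ) < ((k + n : ℕ) : ℝ) := by
      have := Nat.cast_nonneg (α := ℝ) (k + n)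
      linarith
    have h := (integrable_rpow_mul_exp_neg_mul_sq hb hpos).const_mul a
    refine h.congr (Filter.Eventually.of_forall fun x => ?_)
    simp only [Real.rpow_natCast, Polynomial.eval_monomial, pow_add]
    ring

open Polynomial in
theorem Polynomial.derivative_hermite_succ (n : ℕ) :
    derivative (hermite (n + 1)) = ((n : ℤ[X]) + 1) * hermite n := by
  induction n with
  | zero => simp
  | succ n ih =>
    rw [hermite_succ (n + 1), derivative_sub, derivative_mul, ih, derivative_mul, hermite_succ n]
    simp
    ring

/-- The square-root norm of `He_n`, so that `p_n = He_n / hermiteNorm n`. -/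
noncomputable def hermiteNorm (n : ℕ) : ℝ :=
  Real.sqrt (Real.sqrt (2 * Real.pi) * (n ! : ℝ))

theorem hermiteNorm_pos (n : ℕ) : 0 < hermiteNorm n :=
  Real.sqrt_pos.2 (mul_pos (Real.sqrt_pos.2 (by positivity)) (by exact_mod_cast n.factorial_pos))

theorem hermiteNorm_succ (n : ℕ) :
    hermiteNorm (n + 1) = Real.sqrt ((n : ℝ) + 1) * hermiteNorm n := by
  rw [hermiteNorm, hermiteNorm, ← Real.sqrt_mul (by positivity), Nat.factorial_succ]
  push_cast
  congr 1
  ring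

theorem sqrt_succ_mul_self (n : ℕ) :
    Real.sqrt ((n : ℝ) + 1) * Real.sqrt ((n : ℝ) + 1) = (n : ℝ) + 1 :=
  Real.mul_self_sqrt (by positivity)

theorem hasDerivAt_pOrtho_succ (n : ℕ) (x : ℝ) :
    HasDerivAt (pOrtho (n + 1)) (Real.sqrt ((n : ℝ) + 1) * pOrtho n x) x := by
  have h := ((Polynomial.hermite (n + 1)).hasDerivAt_aeval x).div_const (hermiteNorm (n + 1))
  refine h.congr_deriv ?_
  have h0 := (hermiteNorm_pos n).ne'
  have h1 : Real.sqrt ((n : ℝ) + 1) ≠ 0 := (Real.sqrt_pos.2 (by positivity)).ne'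
  change _ = _ * (_ / hermiteNorm n)
  rw [Polynomial.derivative_hermite_succ, hermiteNorm_succ]
  simp only [map_mul, map_add, map_natCast, map_one]
  field_simp
  rw [Real.sq_sqrt (by positivity)]
  ring

theorem hasDerivAt_pOrtho (n : ℕ) (x : ℝ) :
    HasDerivAt (pOrtho n) (x * pOrtho n x - Real.sqrt ((n : ℝ) + 1) * pOrtho (n + 1) x) x := by
  have h := ((Polynomial.hermite n).hasDerivAt_aeval x).div_const (hermiteNorm n)
  refine h.congr_deriv ?_
  have h0 := (hermiteNorm_pos n).ne'
  have h1 : Real.sqrt ((n : ℝ) + 1) ≠ 0 := (Real.sqrt_pos.2 (by positivity)).ne'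
  change _ = x * (_ / hermiteNorm n) - _ * (_ / hermiteNorm (n + 1))
  rw [hermiteNorm_succ, Polynomial.hermite_succ]
  simp only [map_sub, map_mul, Polynomial.aeval_X]
  field_simp
  ring

/-- The Hermite functions `e^{-x²/4} p_n(x)`, orthonormal in `L²(ℝ)`. -/
noncomputable def hermiteFun (n : ℕ) (x : ℝ) : ℝ :=
  Real.exp (-x ^ 2 / 4) * pOrtho n x

theorem hasDerivAt_exp_neg_sq_div_four (x : ℝ) :
    HasDerivAt (fun x : ℝ => Real.exp (-x ^ 2 / 4)) (Real.exp (-x ^ 2 / 4) * (-x / 2)) x := by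
  refine (((hasDerivAt_pow 2 x).neg.div_const 4).exp).congr_deriv ?_
  norm_num
  ring

theorem hasDerivAt_hermiteFun_succ (n : ℕ) (x : ℝ) :
    HasDerivAt (hermiteFun (n + 1))
      (-(1 / 2) * (x * hermiteFun (n + 1) x) + Real.sqrt ((n : ℝ) + 1) * hermiteFun n x) x := by
  refine ((hasDerivAt_exp_neg_sq_div_four x).mul (hasDerivAt_pOrtho_succ n x)).congr_deriv ?_
  simp only [hermiteFun]
  ring

theorem hasDerivAt_hermiteFun (n : ℕ) (x : ℝ) :
    HasDerivAt (hermiteFun n)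
      (1 / 2 * (x * hermiteFun n x) + -Real.sqrt ((n : ℝ) + 1) * hermiteFun (n + 1) x) x := by
  refine ((hasDerivAt_exp_neg_sq_div_four x).mul (hasDerivAt_pOrtho n x)).congr_deriv ?_
  simp only [hermiteFun]
  ring

theorem hasDerivAt_hermiteFun_zero (x : ℝ) :
    HasDerivAt (hermiteFun 0) (-(1 / 2) * hermiteFun 1 x) x := by
  refine (hasDerivAt_hermiteFun 0 x).congr_deriv ?_
  have h : HasDerivAt (pOrtho 0) 0 x := by
    have : pOrtho 0 = fun _ => 1 / hermiteNorm 0 := by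
      funext y
      simp [pOrtho, hermiteNorm]
    rw [this]
    exact hasDerivAt_const _ _
  have h' := h.unique (hasDerivAt_pOrtho 0 x)
  simp only [Nat.cast_zero, zero_add, Real.sqrt_one, one_mul] at h' ⊢
  simp only [hermiteFun]
  linear_combination -(1 / 2) * Real.exp (-x ^ 2 / 4) * h'

theorem hasDerivAt_hermiteFun_three_term (n : ℕ) (x : ℝ) :
    HasDerivAt (hermiteFun (n + 1))
      (1 / 2 * Real.sqrt ((n : ℝ) + 1) * hermiteFun n x +
        -(1 / 2) * Real.sqrt ((n : ℝ) + 2) * hermiteFun (n + 2) x) x := by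
  have h₁ := hasDerivAt_hermiteFun_succ n x
  have h₂ := hasDerivAt_hermiteFun (n + 1) x
  refine h₁.congr_deriv ?_
  have h := h₁.unique h₂
  rw [show (((n + 1 : ℕ) : ℝ) + 1) = (n : ℝ) + 2 by push_cast; ring] at h
  linear_combination (1 / 2) * h

theorem continuous_hermiteFun (n : ℕ) : Continuous (hermiteFun n) :=
  continuous_iff_continuousAt.2 fun x => (hasDerivAt_hermiteFun n x).continuousAt

theorem hasMoments_hermiteFun (n : ℕ) : HasMoments (hermiteFun n) := by
  have h := (((Polynomial.hermite n).map (algebraMap ℤ ℝ)).hasMoments_mul_exp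
    (b := 1 / 4) (by norm_num)).const_mul (hermiteNorm n)⁻¹
  convert h using 2 with x
  rw [Polynomial.eval_map_algebraMap, hermiteFun, show -x ^ 2 / 4 = -(1 / 4) * x ^ 2 by ring]
  change _ * (_ / hermiteNorm n) = _
  ring

theorem hasMoments_hermiteFun_mul (m n : ℕ) :
    HasMoments fun x => hermiteFun m x * hermiteFun n x := by
  have h := (((Polynomial.hermite m * Polynomial.hermite n).map
    (algebraMap ℤ ℝ)).hasMoments_mul_exp
    (b := 1 / 2) (by norm_num)).const_mul ((hermiteNorm m)⁻¹ * (hermiteNorm n)⁻¹)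
  convert h using 2 with x
  rw [Polynomial.eval_map_algebraMap, hermiteFun, hermiteFun, map_mul,
    show -(1 / 2) * x ^ 2 = -x ^ 2 / 4 + -x ^ 2 / 4 by ring, Real.exp_add]
  change _ * (_ / hermiteNorm m) * (_ * (_ / hermiteNorm n)) = _
  ring

theorem powerMoment_zero (f : ℝ → ℝ) : powerMoment f 0 = ∫ x, f x := by
  simp [powerMoment]

theorem qFun_eq (n : ℕ) (x : ℝ) : qFun n x = ∫ t in Set.Iic x, hermiteFun n t := rfl

theorem integrable_hermiteFun (n : ℕ) : Integrable (hermiteFun n) :=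
  (hasMoments_hermiteFun n).integrable

theorem hasDerivAt_qFun (n : ℕ) (x : ℝ) : HasDerivAt (qFun n) (hermiteFun n x) x := by
  have h : qFun n = fun y => qFun n 0 + ∫ t in (0 : ℝ)..y, hermiteFun n t := by
    funext y
    rw [← intervalIntegral.integral_Iic_sub_Iic (integrable_hermiteFun n).integrableOn
      (integrable_hermiteFun n).integrableOn, qFun_eq, qFun_eq]
    ring
  rw [h]
  exact ((continuous_hermiteFun n).integral_hasStrictDerivAt 0 x).hasDerivAt.const_add _

theorem continuous_qFun (n : ℕ) : Continuous (qFun n) :=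
  continuous_iff_continuousAt.2 fun x => (hasDerivAt_qFun n x).continuousAt

theorem abs_qFun_le (n : ℕ) (x : ℝ) : |qFun n x| ≤ ∫ t, |hermiteFun n t| :=
  (abs_integral_le_integral_abs).trans
    (setIntegral_le_integral (integrable_hermiteFun n).abs
      (Filter.Eventually.of_forall fun _ => abs_nonneg _))

theorem tendsto_qFun_atBot (n : ℕ) : Filter.Tendsto (qFun n) Filter.atBot (nhds 0) :=
  tendsto_integral_Iic_zero Filter.tendsto_id

theorem tendsto_qFun_atTop (n : ℕ) :
    Filter.Tendsto (qFun n) Filter.atTop (nhds (∫ x, hermiteFun n x)) :=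
  (aecover_Iic Filter.tendsto_id).integral_tendsto_of_countably_generated (integrable_hermiteFun n)

theorem hasMoments_qFun_mul (m n : ℕ) : HasMoments fun x => qFun m x * hermiteFun n x :=
  (hasMoments_hermiteFun n).bdd_mul (continuous_qFun m) (abs_qFun_le m)

theorem tendsto_hermiteFun_atBot (n : ℕ) :
    Filter.Tendsto (hermiteFun n) Filter.atBot (nhds 0) :=
  tendsto_zero_of_hasDerivAt_of_integrableOn_Iic (a := 0)
    (fun x _ => hasDerivAt_hermiteFun n x)
    ((((hasMoments_hermiteFun n).id_mul.const_mul _).add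
      ((hasMoments_hermiteFun (n + 1)).const_mul _)).integrable.integrableOn)
    (integrable_hermiteFun n).integrableOn

theorem qFun_one (x : ℝ) : qFun 1 x = -2 * hermiteFun 0 x := by
  have h := integral_Iic_of_hasDerivAt_of_tendsto' (a := x)
    (fun y _ => hasDerivAt_hermiteFun_zero y)
    ((integrable_hermiteFun 1).const_mul _).integrableOn (tendsto_hermiteFun_atBot 0)
  rw [integral_const_mul, ← qFun_eq] at h
  linear_combination -2 * h

theorem qFun_add_two (n : ℕ) (x : ℝ) :
    Real.sqrt ((n : ℝ) + 2) * qFun (n + 2) x =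
      Real.sqrt ((n : ℝ) + 1) * qFun n x - 2 * hermiteFun (n + 1) x := by
  have h₁ := (integrable_hermiteFun n).const_mul (1 / 2 * Real.sqrt ((n : ℝ) + 1))
  have h₂ := (integrable_hermiteFun (n + 2)).const_mul (-(1 / 2) * Real.sqrt ((n : ℝ) + 2))
  have h := integral_Iic_of_hasDerivAt_of_tendsto' (a := x)
    (fun y _ => hasDerivAt_hermiteFun_three_term n y)
    (h₁.add h₂).integrableOn (tendsto_hermiteFun_atBot (n + 1))
  rw [integral_add h₁.integrableOn h₂.integrableOn, integral_const_mul, integral_const_mul,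
    ← qFun_eq, ← qFun_eq] at h
  linear_combination -2 * h

theorem integral_hermiteFun_add_two (n : ℕ) :
    Real.sqrt ((n : ℝ) + 2) * ∫ x, hermiteFun (n + 2) x =
      Real.sqrt ((n : ℝ) + 1) * ∫ x, hermiteFun n x := by
  have h₁ := (integrable_hermiteFun n).const_mul (1 / 2 * Real.sqrt ((n : ℝ) + 1))
  have h₂ := (integrable_hermiteFun (n + 2)).const_mul (-(1 / 2) * Real.sqrt ((n : ℝ) + 2))
  have h := integral_eq_zero_of_hasDerivAt_of_integrable (hasDerivAt_hermiteFun_three_term n)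
    (h₁.add h₂) (integrable_hermiteFun (n + 1))
  rw [integral_add h₁ h₂, integral_const_mul, integral_const_mul] at h
  linear_combination -2 * h

theorem integral_hermiteFun_odd (k : ℕ) : ∫ x, hermiteFun (2 * k + 1) x = 0 := by
  induction k with
  | zero =>
    have h := integral_eq_zero_of_hasDerivAt_of_integrable hasDerivAt_hermiteFun_zero
      ((integrable_hermiteFun 1).const_mul _) (integrable_hermiteFun 0)
    rw [integral_const_mul] at h
    simpa using h
  | succ k ih =>
    have h := integral_hermiteFun_add_two (2 * k + 1)
    rw [ih, mul_zero] at h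
    exact (mul_eq_zero.1 h).resolve_left (Real.sqrt_pos.2 (by positivity)).ne'

theorem integral_hermiteFun_mul_succ (n : ℕ) :
    (∫ x, hermiteFun n x) * ∫ x, hermiteFun (n + 1) x = 0 := by
  obtain ⟨k, rfl | rfl⟩ := n.even_or_odd'
  · rw [integral_hermiteFun_odd, mul_zero]
  · rw [integral_hermiteFun_odd, zero_mul]

theorem pOrtho_zero (x : ℝ) : pOrtho 0 x = (hermiteNorm 0)⁻¹ := by
  simp [pOrtho, hermiteNorm]

theorem hermiteNorm_zero_sq : hermiteNorm 0 ^ 2 = Real.sqrt (2 * Real.pi) := by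
  rw [hermiteNorm, Real.sq_sqrt (by positivity)]
  simp

theorem integral_hermiteFun_sq (n : ℕ) : ∫ x, hermiteFun n x * hermiteFun n x = 1 := by
  induction n with
  | zero =>
    have h : ∀ x, hermiteFun 0 x * hermiteFun 0 x =
        (hermiteNorm 0 ^ 2)⁻¹ * Real.exp (-(1 / 2) * x ^ 2) := by
      intro x
      rw [hermiteFun, pOrtho_zero, show -(1 / 2) * x ^ 2 = -x ^ 2 / 4 + -x ^ 2 / 4 by ring,
        Real.exp_add]
      ring
    simp_rw [h]
    rw [integral_const_mul, integral_gaussian, hermiteNorm_zero_sq,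
      show Real.pi / (1 / 2) = 2 * Real.pi by ring]
    exact inv_mul_cancel₀ (Real.sqrt_pos.2 (by positivity)).ne'
  | succ n ih =>
    have h₁ := (hasMoments_hermiteFun_mul n n).integrable.const_mul (Real.sqrt ((n : ℝ) + 1))
    have h₂ := (hasMoments_hermiteFun_mul (n + 1) (n + 1)).integrable.const_mul
      (-Real.sqrt ((n : ℝ) + 1))
    have hd : ∀ x, HasDerivAt (fun x => hermiteFun (n + 1) x * hermiteFun n x)
        (Real.sqrt ((n : ℝ) + 1) * (hermiteFun n x * hermiteFun n x) +
          -Real.sqrt ((n : ℝ) + 1) * (hermiteFun (n + 1) x * hermiteFun (n + 1) x)) x := by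
      intro x
      refine ((hasDerivAt_hermiteFun_succ n x).mul (hasDerivAt_hermiteFun n x)).congr_deriv ?_
      ring
    have h := integral_eq_zero_of_hasDerivAt_of_integrable hd (h₁.add h₂)
      (hasMoments_hermiteFun_mul (n + 1) n).integrable
    rw [integral_add h₁ h₂, integral_const_mul, integral_const_mul, ih] at h
    have hs : Real.sqrt ((n : ℝ) + 1) ≠ 0 := (Real.sqrt_pos.2 (by positivity)).ne'
    apply mul_left_cancel₀ hs
    linear_combination -h

theorem integral_qFun_mul_swap (n : ℕ) :
    ∫ x, qFun n x * hermiteFun (n + 1) x = -∫ x, qFun (n + 1) x * hermiteFun n x := by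
  have h₁ := (hasMoments_qFun_mul (n + 1) n).integrable
  have h₂ := (hasMoments_qFun_mul n (n + 1)).integrable
  have h := integral_of_hasDerivAt_of_tendsto
    (fun x => (hasDerivAt_qFun n x).mul (hasDerivAt_qFun (n + 1) x))
    ((h₁.add h₂).congr (Filter.Eventually.of_forall fun x => by
      simp only [Pi.add_apply]; ring))
    ((tendsto_qFun_atBot n).mul (tendsto_qFun_atBot (n + 1)))
    ((tendsto_qFun_atTop n).mul (tendsto_qFun_atTop (n + 1)))
  rw [integral_hermiteFun_mul_succ] at h
  simp_rw [mul_comm (hermiteFun n _)] at h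
  rw [integral_add h₁ h₂] at h
  linear_combination h

theorem integral_qFun_succ_mul (n : ℕ) :
    Real.sqrt ((n : ℝ) + 1) * ∫ x, qFun (n + 1) x * hermiteFun n x = -(1 + (-1) ^ n) := by
  induction n with
  | zero =>
    simp_rw [zero_add, qFun_one, mul_assoc]
    rw [integral_const_mul, integral_hermiteFun_sq]
    norm_num
  | succ n ih =>
    have h₁ := (hasMoments_qFun_mul n (n + 1)).integrable.const_mul (Real.sqrt ((n : ℝ) + 1))
    have h₂ := (hasMoments_hermiteFun_mul (n + 1) (n + 1)).integrable.const_mul (-2)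
    rw [← integral_const_mul]
    have h : ∀ x, Real.sqrt (((n + 1 : ℕ) : ℝ) + 1) *
        (qFun (n + 1 + 1) x * hermiteFun (n + 1) x) =
        Real.sqrt ((n : ℝ) + 1) * (qFun n x * hermiteFun (n + 1) x) +
          -2 * (hermiteFun (n + 1) x * hermiteFun (n + 1) x) := by
      intro x
      rw [show (((n + 1 : ℕ) : ℝ) + 1) = (n : ℝ) + 2 by push_cast; ring]
      linear_combination hermiteFun (n + 1) x * qFun_add_two n x
    simp_rw [h]
    rw [integral_add h₁ h₂, integral_const_mul, integral_const_mul, integral_hermiteFun_sq,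
      integral_qFun_mul_swap, pow_succ]
    linear_combination -ih

theorem Dconst_add_two (k : ℕ) :
    Real.sqrt (((2 * k : ℕ) : ℝ) + 2) * Dconst (2 * k + 2) =
      Real.sqrt (((2 * k : ℕ) : ℝ) + 1) * Dconst (2 * k) := by
  have hd : ∀ m : ℕ, (0 : ℝ) < (Nat.doubleFactorial m : ℝ) := fun m => by
    exact_mod_cast Nat.doubleFactorial_pos m
  have h : (Nat.doubleFactorial (2 * k + 1) : ℝ) =
      (((2 * k : ℕ) : ℝ) + 1) * (Nat.doubleFactorial (2 * k - 1) : ℝ) := by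
    exact_mod_cast Nat.doubleFactorial_add_one (2 * k)
  have h' : (Nat.doubleFactorial (2 * k + 2) : ℝ) =
      (((2 * k : ℕ) : ℝ) + 2) * (Nat.doubleFactorial (2 * k) : ℝ) := by
    exact_mod_cast Nat.doubleFactorial_add_two (2 * k)
  simp only [Dconst, show 2 * k + 2 - 1 = 2 * k + 1 from rfl]
  rw [mul_left_comm, mul_left_comm (Real.sqrt _), ← Real.sqrt_mul (by positivity),
    ← Real.sqrt_mul (by positivity), h, h']
  congr 2
  have := (hd (2 * k)).ne'
  field_simp

theorem integral_hermiteFun_even (k : ℕ) : ∫ x, hermiteFun (2 * k) x = Dconst (2 * k) := by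
  induction k with
  | zero =>
    have h : ∀ x, hermiteFun 0 x = (hermiteNorm 0)⁻¹ * Real.exp (-(1 / 4) * x ^ 2) := by
      intro x
      rw [hermiteFun, pOrtho_zero, show -(1 / 4) * x ^ 2 = -x ^ 2 / 4 by ring, mul_comm]
    simp_rw [mul_zero, h]
    rw [integral_const_mul, integral_gaussian]
    have hD : Dconst 0 = Real.pi ^ ((1 : ℝ) / 4) * (2 : ℝ) ^ ((3 : ℝ) / 4) := by
      simp [Dconst]
    have hn : hermiteNorm 0 = (2 * Real.pi) ^ ((1 : ℝ) / 4) := by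
      rw [hermiteNorm]
      simp only [Nat.factorial_zero, Nat.cast_one, mul_one, Real.sqrt_eq_rpow]
      rw [← Real.rpow_mul (by positivity)]
      norm_num
    have hs : Real.sqrt (Real.pi / (1 / 4)) = 2 * Real.pi ^ ((1 : ℝ) / 2) := by
      rw [show Real.pi / (1 / 4) = 2 ^ 2 * Real.pi by ring, Real.sqrt_mul (by positivity),
        Real.sqrt_sq (by norm_num), Real.sqrt_eq_rpow]
    have h2 : (2 : ℝ) = 2 ^ ((1 : ℝ) / 4) * 2 ^ ((3 : ℝ) / 4) := by
      rw [← Real.rpow_add (by norm_num)]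
      norm_num
    have hp : Real.pi ^ ((1 : ℝ) / 2) = Real.pi ^ ((1 : ℝ) / 4) * Real.pi ^ ((1 : ℝ) / 4) := by
      rw [← Real.rpow_add Real.pi_pos]
      norm_num
    rw [inv_mul_eq_iff_eq_mul₀ (hermiteNorm_pos 0).ne', hs, hn, hD, hp,
      Real.mul_rpow (by norm_num) Real.pi_pos.le]
    linear_combination (Real.pi ^ ((1 : ℝ) / 4) * Real.pi ^ ((1 : ℝ) / 4)) * h2
  | succ k ih =>
    have h := integral_hermiteFun_add_two (2 * k)
    rw [ih, ← Dconst_add_two k] at h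
    exact mul_left_cancel₀ (Real.sqrt_pos.2 (by positivity)).ne' h

theorem Dconst_pos (n : ℕ) : 0 < Dconst n := by
  have hd : ∀ m : ℕ, (0 : ℝ) < (Nat.doubleFactorial m : ℝ) := fun m => by
    exact_mod_cast Nat.doubleFactorial_pos m
  exact mul_pos (mul_pos (Real.rpow_pos_of_pos Real.pi_pos _) (by positivity))
    (Real.sqrt_pos.2 (div_pos (hd _) (hd _)))

/-- The antiderivative of `hermiteFun N / 2` appearing in the GOE density. -/
noncomputable def goeKernel (N : ℕ) (x : ℝ) : ℝ :=
  1 / 2 * qFun N x + Aconst N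

theorem hasDerivAt_goeKernel (N : ℕ) (x : ℝ) :
    HasDerivAt (goeKernel N) (1 / 2 * hermiteFun N x) x :=
  ((hasDerivAt_qFun N x).const_mul _).add_const _

theorem goeKernel_mul_eq (N n : ℕ) (x : ℝ) :
    goeKernel N x * hermiteFun n x =
      1 / 2 * (qFun N x * hermiteFun n x) + Aconst N * hermiteFun n x := by
  rw [goeKernel]
  ring

theorem hasMoments_goeKernel_mul (N n : ℕ) :
    HasMoments fun x => goeKernel N x * hermiteFun n x := by
  simp_rw [goeKernel_mul_eq]
  exact ((hasMoments_qFun_mul N n).const_mul _).add ((hasMoments_hermiteFun n).const_mul _)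

theorem sqrt_mul_Aconst_mul_integral (n : ℕ) :
    Real.sqrt ((n : ℝ) + 1) * (Aconst (n + 1) * ∫ x, hermiteFun n x) = (1 + (-1) ^ n) / 2 := by
  obtain ⟨k, rfl | rfl⟩ := n.even_or_odd'
  · have hs : Real.sqrt (((2 * k : ℕ) : ℝ) + 1) ≠ 0 := (Real.sqrt_pos.2 (by positivity)).ne'
    have hD := (Dconst_pos (2 * k)).ne'
    rw [integral_hermiteFun_even, Aconst, if_neg (by omega), Nat.add_sub_cancel, Nat.cast_succ]
    field_simp
    norm_num
  · rw [integral_hermiteFun_odd]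
    norm_num [pow_succ]

theorem integral_goeKernel_succ_mul (n : ℕ) :
    ∫ x, goeKernel (n + 1) x * hermiteFun n x = 0 := by
  have hs : Real.sqrt ((n : ℝ) + 1) ≠ 0 := (Real.sqrt_pos.2 (by positivity)).ne'
  simp_rw [goeKernel_mul_eq]
  rw [integral_add ((hasMoments_qFun_mul _ _).integrable.const_mul _)
    ((integrable_hermiteFun n).const_mul _), integral_const_mul, integral_const_mul]
  apply mul_left_cancel₀ hs
  linear_combination 1 / 2 * integral_qFun_succ_mul n + sqrt_mul_Aconst_mul_integral n

theorem goeDensity_succ (n : ℕ) (x : ℝ) :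
    goeDensity (n + 1) x =
      Real.sqrt ((n : ℝ) + 1) *
        (-1 * (x * (hermiteFun (n + 1) x * hermiteFun n x)) +
          Real.sqrt ((n : ℝ) + 1) * (hermiteFun n x * hermiteFun n x) +
          Real.sqrt ((n : ℝ) + 1) * (hermiteFun (n + 1) x * hermiteFun (n + 1) x) +
          goeKernel (n + 1) x * hermiteFun n x) := by
  rw [goeDensity, Nat.add_sub_cancel, (hasDerivAt_pOrtho_succ n x).deriv,
    (hasDerivAt_pOrtho n x).deriv, show -x ^ 2 / 2 = -x ^ 2 / 4 + -x ^ 2 / 4 by ring,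
    Real.exp_add, Nat.cast_succ]
  simp only [hermiteFun, goeKernel]
  ring

section Moments

variable (n : ℕ)

/-- The moments of `hermiteFun (n + 1) ^ 2`. -/
noncomputable def momSqSucc (k : ℕ) : ℝ :=
  powerMoment (fun x => hermiteFun (n + 1) x * hermiteFun (n + 1) x) k

/-- The moments of `hermiteFun (n + 1) * hermiteFun n`. -/
noncomputable def momCross (k : ℕ) : ℝ :=
  powerMoment (fun x => hermiteFun (n + 1) x * hermiteFun n x) k

/-- The moments of `hermiteFun n ^ 2`. -/
noncomputable def momSq (k : ℕ) : ℝ :=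
  powerMoment (fun x => hermiteFun n x * hermiteFun n x) k

/-- The moments of `goeKernel (n + 1) * hermiteFun (n + 1)`. -/
noncomputable def momKernelSucc (k : ℕ) : ℝ :=
  powerMoment (fun x => goeKernel (n + 1) x * hermiteFun (n + 1) x) k

/-- The moments of `goeKernel (n + 1) * hermiteFun n`. -/
noncomputable def momKernel (k : ℕ) : ℝ :=
  powerMoment (fun x => goeKernel (n + 1) x * hermiteFun n x) k

theorem momSqSucc_recurrence (k : ℕ) :
    (k : ℝ) * momSqSucc n (k - 1) - momSqSucc n (k + 1) +
      2 * Real.sqrt ((n : ℝ) + 1) * momCross n k = 0 := by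
  have ha := hasMoments_hermiteFun_mul (n + 1) (n + 1)
  have hb := hasMoments_hermiteFun_mul (n + 1) n
  have h := ha.powerMoment_deriv
    ((ha.id_mul.const_mul (-1)).add (hb.const_mul (2 * Real.sqrt ((n : ℝ) + 1))))
    (fun x => ((hasDerivAt_hermiteFun_succ n x).mul
      (hasDerivAt_hermiteFun_succ n x)).congr_deriv (by ring)) k
  rw [(ha.id_mul.const_mul _).powerMoment_add (hb.const_mul _), powerMoment_const_mul,
    powerMoment_const_mul, powerMoment_id_mul] at h
  simp only [momSqSucc, momCross]
  linear_combination h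

theorem momCross_recurrence (k : ℕ) :
    (k : ℝ) * momCross n (k - 1) + Real.sqrt ((n : ℝ) + 1) * momSq n k -
      Real.sqrt ((n : ℝ) + 1) * momSqSucc n k = 0 := by
  have ha := hasMoments_hermiteFun_mul (n + 1) (n + 1)
  have hc := hasMoments_hermiteFun_mul n n
  have h := (hasMoments_hermiteFun_mul (n + 1) n).powerMoment_deriv
    ((hc.const_mul (Real.sqrt ((n : ℝ) + 1))).add (ha.const_mul (-Real.sqrt ((n : ℝ) + 1))))
    (fun x => ((hasDerivAt_hermiteFun_succ n x).mul
      (hasDerivAt_hermiteFun n x)).congr_deriv (by ring)) k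
  rw [(hc.const_mul _).powerMoment_add (ha.const_mul _), powerMoment_const_mul,
    powerMoment_const_mul] at h
  simp only [momSqSucc, momCross, momSq]
  linear_combination h

theorem momSq_recurrence (k : ℕ) :
    (k : ℝ) * momSq n (k - 1) + momSq n (k + 1) -
      2 * Real.sqrt ((n : ℝ) + 1) * momCross n k = 0 := by
  have hc := hasMoments_hermiteFun_mul n n
  have hb := hasMoments_hermiteFun_mul (n + 1) n
  have h := hc.powerMoment_deriv
    ((hc.id_mul.const_mul 1).add (hb.const_mul (-(2 * Real.sqrt ((n : ℝ) + 1)))))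
    (fun x => ((hasDerivAt_hermiteFun n x).mul
      (hasDerivAt_hermiteFun n x)).congr_deriv (by ring)) k
  rw [(hc.id_mul.const_mul _).powerMoment_add (hb.const_mul _), powerMoment_const_mul,
    powerMoment_const_mul, powerMoment_id_mul] at h
  simp only [momSq, momCross]
  linear_combination h

theorem momKernelSucc_recurrence (k : ℕ) :
    (k : ℝ) * momKernelSucc n (k - 1) + 1 / 2 * momSqSucc n k - 1 / 2 * momKernelSucc n (k + 1) +
      Real.sqrt ((n : ℝ) + 1) * momKernel n k = 0 := by
  have ha := (hasMoments_hermiteFun_mul (n + 1) (n + 1)).const_mul (1 / 2)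
  have hu := hasMoments_goeKernel_mul (n + 1) (n + 1)
  have hu' := hu.id_mul.const_mul (-(1 / 2))
  have hv := (hasMoments_goeKernel_mul (n + 1) n).const_mul (Real.sqrt ((n : ℝ) + 1))
  have h := hu.powerMoment_deriv ((ha.add hu').add hv)
    (fun x => ((hasDerivAt_goeKernel (n + 1) x).mul
      (hasDerivAt_hermiteFun_succ n x)).congr_deriv (by ring)) k
  rw [(ha.add hu').powerMoment_add hv, ha.powerMoment_add hu', powerMoment_const_mul,
    powerMoment_const_mul, powerMoment_const_mul, powerMoment_id_mul] at h
  simp only [momSqSucc, momKernelSucc, momKernel]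
  linear_combination h

theorem momKernel_recurrence (k : ℕ) :
    (k : ℝ) * momKernel n (k - 1) + 1 / 2 * momCross n k + 1 / 2 * momKernel n (k + 1) -
      Real.sqrt ((n : ℝ) + 1) * momKernelSucc n k = 0 := by
  have hb := (hasMoments_hermiteFun_mul (n + 1) n).const_mul (1 / 2)
  have hv := hasMoments_goeKernel_mul (n + 1) n
  have hv' := hv.id_mul.const_mul (1 / 2)
  have hu := (hasMoments_goeKernel_mul (n + 1) (n + 1)).const_mul (-Real.sqrt ((n : ℝ) + 1))
  have h := hv.powerMoment_deriv ((hb.add hv').add hu)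
    (fun x => ((hasDerivAt_goeKernel (n + 1) x).mul
      (hasDerivAt_hermiteFun n x)).congr_deriv (by ring)) k
  rw [(hb.add hv').powerMoment_add hu, hb.powerMoment_add hv', powerMoment_const_mul,
    powerMoment_const_mul, powerMoment_const_mul, powerMoment_id_mul] at h
  simp only [momCross, momKernelSucc, momKernel]
  linear_combination h

theorem goeMoment_succ_eq (p : ℕ) :
    goeMoment (n + 1) p =
      Real.sqrt ((n : ℝ) + 1) *
        (-momCross n (2 * p + 1) + Real.sqrt ((n : ℝ) + 1) * momSq n (2 * p) +
          Real.sqrt ((n : ℝ) + 1) * momSqSucc n (2 * p) + momKernel n (2 * p)) := by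
  have hb := (hasMoments_hermiteFun_mul (n + 1) n).id_mul.const_mul (-1)
  have hc := (hasMoments_hermiteFun_mul n n).const_mul (Real.sqrt ((n : ℝ) + 1))
  have ha := (hasMoments_hermiteFun_mul (n + 1) (n + 1)).const_mul (Real.sqrt ((n : ℝ) + 1))
  have hv := hasMoments_goeKernel_mul (n + 1) n
  change powerMoment (fun x => goeDensity (n + 1) x) (2 * p) = _
  simp_rw [goeDensity_succ]
  rw [powerMoment_const_mul, ((hb.add hc).add ha).powerMoment_add hv,
    (hb.add hc).powerMoment_add ha, hb.powerMoment_add hc, powerMoment_const_mul,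
    powerMoment_const_mul, powerMoment_const_mul, powerMoment_id_mul]
  simp only [momSqSucc, momCross, momSq, momKernel]
  ring

theorem momSqSucc_zero : momSqSucc n 0 = 1 := by
  rw [momSqSucc, powerMoment_zero, integral_hermiteFun_sq]

theorem momSq_zero : momSq n 0 = 1 := by
  rw [momSq, powerMoment_zero, integral_hermiteFun_sq]

theorem momKernel_zero : momKernel n 0 = 0 := by
  rw [momKernel, powerMoment_zero, integral_goeKernel_succ_mul]

theorem momCross_one : momCross n 1 = Real.sqrt ((n : ℝ) + 1) := by
  have h₁ := momSqSucc_recurrence n 1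
  have h₂ := momSq_recurrence n 1
  have h₃ := momCross_recurrence n 2
  norm_num [momSqSucc_zero, momSq_zero] at h₁ h₂ h₃
  linear_combination 1 / 2 * h₃ - Real.sqrt ((n : ℝ) + 1) / 2 * (h₁ + h₂)

theorem goeMoment_succ_zero : goeMoment (n + 1) 0 = (n : ℝ) + 1 := by
  have hs := sqrt_succ_mul_self n
  rw [goeMoment_succ_eq, mul_zero, zero_add, momSqSucc_zero, momSq_zero, momKernel_zero,
    momCross_one]
  linear_combination hs

theorem goeMoment_succ_one : goeMoment (n + 1) 1 = ((n : ℝ) + 1) * ((n : ℝ) + 1 + 1) := by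
  have hs := sqrt_succ_mul_self n
  have a1 := momSqSucc_recurrence n 1
  have c1 := momSq_recurrence n 1
  have a3 := momSqSucc_recurrence n 3
  have c3 := momSq_recurrence n 3
  have b4 := momCross_recurrence n 4
  have v1 := momKernel_recurrence n 1
  have u0 := momKernelSucc_recurrence n 0
  norm_num [momSqSucc_zero, momSq_zero, momKernel_zero, momCross_one] at a1 c1 a3 c3 b4 v1 u0
  rw [goeMoment_succ_eq, mul_one]
  generalize Real.sqrt ((n : ℝ) + 1) = s at *
  rw [← hs]
  linear_combination -(s / 4) * b4 + s ^ 2 / 4 * (a3 + c3) + 2 * s * v1 - 4 * s ^ 2 * u0 +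
    s ^ 2 / 4 * (c1 - a1)

theorem goeMoment_succ_recurrence (r : ℕ) :
    ((r : ℝ) + 5) * goeMoment (n + 1) (r + 4) =
      (4 * ((r : ℝ) + 4) - 1) * (2 * ((n : ℝ) + 1) - 1) * goeMoment (n + 1) (r + 3) +
        (2 * ((r : ℝ) + 4) - 3) *
          (10 * ((r : ℝ) + 4) ^ 2 - 9 * ((r : ℝ) + 4) - 8 * ((n : ℝ) + 1) ^ 2 +
            8 * ((n : ℝ) + 1)) * goeMoment (n + 1) (r + 2) -
        5 * (2 * ((r : ℝ) + 4) - 3) * (2 * ((r : ℝ) + 4) - 4) * (2 * ((r : ℝ) + 4) - 5) *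
          (2 * ((n : ℝ) + 1) - 1) * goeMoment (n + 1) (r + 1) -
        2 * (2 * ((r : ℝ) + 4) - 3) * (2 * ((r : ℝ) + 4) - 4) * (2 * ((r : ℝ) + 4) - 5) *
          (2 * ((r : ℝ) + 4) - 6) * (2 * ((r : ℝ) + 4) - 7) * goeMoment (n + 1) r := by
  have hs := sqrt_succ_mul_self n
  have a1 := momSqSucc_recurrence n (2 * r + 1)
  have a3 := momSqSucc_recurrence n (2 * r + 3)
  have a5 := momSqSucc_recurrence n (2 * r + 5)
  have a7 := momSqSucc_recurrence n (2 * r + 7)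
  have a9 := momSqSucc_recurrence n (2 * r + 9)
  have b2 := momCross_recurrence n (2 * r + 2)
  have b4 := momCross_recurrence n (2 * r + 4)
  have b6 := momCross_recurrence n (2 * r + 6)
  have b8 := momCross_recurrence n (2 * r + 8)
  have b10 := momCross_recurrence n (2 * r + 10)
  have c1 := momSq_recurrence n (2 * r + 1)
  have c3 := momSq_recurrence n (2 * r + 3)
  have c5 := momSq_recurrence n (2 * r + 5)
  have c7 := momSq_recurrence n (2 * r + 7)
  have c9 := momSq_recurrence n (2 * r + 9)
  have u2 := momKernelSucc_recurrence n (2 * r + 2)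
  have u4 := momKernelSucc_recurrence n (2 * r + 4)
  have u6 := momKernelSucc_recurrence n (2 * r + 6)
  have v1 := momKernel_recurrence n (2 * r + 1)
  have v3 := momKernel_recurrence n (2 * r + 3)
  have v5 := momKernel_recurrence n (2 * r + 5)
  have v7 := momKernel_recurrence n (2 * r + 7)
  simp only [goeMoment_succ_eq, Nat.add_succ_sub_one, Nat.cast_add, Nat.cast_mul, Nat.cast_ofNat,
    mul_add, add_assoc, Nat.reduceMul, Nat.reduceAdd, Nat.cast_one] at *
  simp only [← add_assoc, add_zero] at *
  generalize Real.sqrt ((n : ℝ) + 1) = s at *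
  obtain ⟨P, hP⟩ : ∃ P : ℝ, (r : ℝ) = P - 4 := ⟨(r : ℝ) + 4, by ring⟩
  simp only [hP] at a1 a3 a5 a7 a9 b2 b4 b6 b8 b10 c1 c3 c5 c7 c9 u2 u4 u6 v1 v3 v5 v7 ⊢
  rw [show (n : ℝ) = s * s - 1 by linarith]
  linear_combination
    (720 * s ^ 2 - 1368 * P * s ^ 2 + 952 * P ^ 2 * s ^ 2 - 288 * P ^ 3 * s ^ 2 +
        32 * P ^ 4 * s ^ 2) * a1 +
    (-60 * s ^ 2 + 70 * P * s ^ 2 - 20 * P ^ 2 * s ^ 2 + 120 * s ^ 4 - 140 * P * s ^ 4 +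
        40 * P ^ 2 * s ^ 4) * a3 +
    (-7/2 * s ^ 2 + 10 * P * s ^ 2 - 10 * P ^ 2 * s ^ 2 - 8 * s ^ 4 + 8 * s ^ 6) * a5 +
    (2 * s ^ 2 - 4 * s ^ 4) * a7 +
    (1/2 * s ^ 2) * a9 +
    (-780 * s + 1462 * P * s - 1000 * P ^ 2 * s + 296 * P ^ 3 * s - 32 * P ^ 4 * s) * b2 +
    (153/2 * s - 84 * P * s + 22 * P ^ 2 * s - 132 * s ^ 3 + 148 * P * s ^ 3 -
        40 * P ^ 2 * s ^ 3) * b4 +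
    (1/2 * s - 12 * P * s + 10 * P ^ 2 * s + 10 * s ^ 3 - 8 * s ^ 5) * b6 +
    (-5/2 * s + 4 * s ^ 3) * b8 +
    (-1/2 * s) * b10 +
    (720 * s ^ 2 - 1368 * P * s ^ 2 + 952 * P ^ 2 * s ^ 2 - 288 * P ^ 3 * s ^ 2 +
        32 * P ^ 4 * s ^ 2) * c1 +
    (-72 * s ^ 2 + 84 * P * s ^ 2 - 24 * P ^ 2 * s ^ 2 + 120 * s ^ 4 - 140 * P * s ^ 4 +
        40 * P ^ 2 * s ^ 4) * c3 +
    (3/2 * s ^ 2 + 10 * P * s ^ 2 - 10 * P ^ 2 * s ^ 2 - 12 * s ^ 4 + 8 * s ^ 6) * c5 +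
    (3 * s ^ 2 - 4 * s ^ 4) * c7 +
    (1/2 * s ^ 2) * c9 +
    (-120 * s ^ 2 + 188 * P * s ^ 2 - 96 * P ^ 2 * s ^ 2 + 16 * P ^ 3 * s ^ 2) * u2 +
    (12 * s ^ 2 - 8 * P * s ^ 2 - 24 * s ^ 4 + 16 * P * s ^ 4) * u4 +
    (-4 * s ^ 2 - 4 * P * s ^ 2) * u6 +
    (720 * s - 1368 * P * s + 952 * P ^ 2 * s - 288 * P ^ 3 * s + 32 * P ^ 4 * s) * v1 +
    (12 * s - 38 * P * s + 32 * P ^ 2 * s - 8 * P ^ 3 * s + 96 * s ^ 3 - 112 * P * s ^ 3 +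
        32 * P ^ 2 * s ^ 3) * v3 +
    (2 * s + 4 * P * s - 8 * P ^ 2 * s + 12 * s ^ 3 - 8 * P * s ^ 3) * v5 +
    (2 * s + 2 * P * s) * v7

end Moments

/-- The even GOE moments satisfy `m_0 = N`, `m_2 = N(N+1)`, and Ledoux's
five-term recurrence. -/
theorem goeMoment_recurrence (N : ℕ) (hN : 2 ≤ N) :
    goeMoment N 0 = N ∧ goeMoment N 1 = (N : ℝ) * ((N : ℝ) + 1) ∧
    ∀ p : ℕ, 4 ≤ p →
      ((p : ℝ) + 1) * goeMoment N p =
        (4 * (p : ℝ) - 1) * (2 * (N : ℝ) - 1) * goeMoment N (p - 1) +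
          (2 * (p : ℝ) - 3) *
            (10 * (p : ℝ) ^ 2 - 9 * (p : ℝ) - 8 * (N : ℝ) ^ 2 + 8 * (N : ℝ)) *
            goeMoment N (p - 2) -
          5 * (2 * (p : ℝ) - 3) * (2 * (p : ℝ) - 4) * (2 * (p : ℝ) - 5) * (2 * (N : ℝ) - 1) *
            goeMoment N (p - 3) -
          2 * (2 * (p : ℝ) - 3) * (2 * (p : ℝ) - 4) * (2 * (p : ℝ) - 5) * (2 * (p : ℝ) - 6) *
            (2 * (p : ℝ) - 7) * goeMoment N (p - 4) := by
  obtain ⟨n, rfl⟩ : ∃ n, N = n + 1 := ⟨N - 1, by omega⟩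
  rw [Nat.cast_succ]
  refine ⟨goeMoment_succ_zero n, goeMoment_succ_one n, fun p hp => ?_⟩
  obtain ⟨r, rfl⟩ : ∃ r, p = r + 4 := ⟨p - 4, by omega⟩
  have h := goeMoment_succ_recurrence n r
  simp only [Nat.cast_add, Nat.cast_ofNat, Nat.reduceSubDiff, Nat.add_sub_cancel]
  linear_combination h
end

section
/- Let N ≥ 1 be an integer, g > 0, and let W₁ be the GSE resolvent built from the rescaled GSE density. Then for every z ∈ ℂ∖ℝ, −(1/4)·(g⁴/N⁴)·W₁^{(5)}(z) + 5·((1/4)·z² − (g/N)·(N + 1/4))·(g²/N²)·W₁'''(z) − (3/2)·(g²/N²)·z·W₁''(z) + (−z⁴ + (8N+2)·(g/N)·z² + (−16N² − 8N + 1/2)·(g²/N²))·W₁'(z) + z·(z² − (4N+1)·(g/N))·W₁(z) = 2N·(z² − 4g) − 5g. -/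
open Nat MeasureTheory

/-- The physicists' Hermite polynomials, via the recurrence
`H_0 = 1`, `H_1 = 2x`, `H_{n+2}(x) = 2x·H_{n+1}(x) − 2(n+1)·H_n(x)`. -/
def Hphys : ℕ → ℝ → ℝ
  | 0 => fun _ => 1
  | 1 => fun x => 2 * x
  | n + 2 => fun x => 2 * x * Hphys (n + 1) x - 2 * ((n : ℝ) + 1) * Hphys n x

/-- `Q_n(x) = ∫_{−∞}^{x} e^{−t²/2} H_n(t) dt`. -/
noncomputable def Qfun (n : ℕ) (x : ℝ) : ℝ :=
  ∫ t in Set.Iic x, Real.exp (-t ^ 2 / 2) * Hphys n t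

/-- `B_N = √π·2^{2N+1}·(2N−1)!`. -/
noncomputable def Bconst (N : ℕ) : ℝ :=
  Real.sqrt Real.pi * 2 ^ (2 * N + 1) * ((2 * N - 1)! : ℝ)

/-- The (unscaled) GSE eigenvalue density
`ρ_N(x) = B_N⁻¹(e^{−x²}(H_{2N}'H_{2N−1} − H_{2N}H_{2N−1}') + e^{−x²/2}H_{2N}Q_{2N−1})`. -/
noncomputable def gseDensity (N : ℕ) (x : ℝ) : ℝ :=
  (Bconst N)⁻¹ *
    (Real.exp (-x ^ 2) *
        (deriv (Hphys (2 * N)) x * Hphys (2 * N - 1) x -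
          Hphys (2 * N) x * deriv (Hphys (2 * N - 1)) x) +
      Real.exp (-x ^ 2 / 2) * Hphys (2 * N) x * Qfun (2 * N - 1) x)

/-- The rescaled GSE density `ρ_{(1)}(x) = √(N/g)·ρ_N(√(N/g)·x)`. -/
noncomputable def gseDensityScaled (N : ℕ) (g : ℝ) (x : ℝ) : ℝ :=
  Real.sqrt ((N : ℝ) / g) * gseDensity N (Real.sqrt ((N : ℝ) / g) * x)

/-- The GSE resolvent `W₁(z) = ∫_ℝ ρ_{(1)}(t)/(z − t) dt` for `z ∈ ℂ∖ℝ`. -/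
noncomputable def gseResolvent (N : ℕ) (g : ℝ) (z : ℂ) : ℂ :=
  ∫ t : ℝ, ((gseDensityScaled N g t : ℝ) : ℂ) / (z - (t : ℂ))

open Polynomial

/-- The operator `D` on polynomials with `(p e^{-t²})' = (D p) e^{-t²}`. -/
noncomputable def gaussDeriv (p : ℝ[X]) : ℝ[X] := derivative p - 2 * X * p

/-- The integral of `p` against the Gaussian weight `e^{-t²}`. -/
noncomputable def gaussInt (p : ℝ[X]) : ℝ := ∫ t : ℝ, p.eval t * Real.exp (-t ^ 2)

/-- The Stieltjes transform of `p(t) e^{-t²}`. -/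
noncomputable def gaussStieltjes (p : ℝ[X]) (z : ℂ) : ℂ :=
  ∫ t : ℝ, ((p.eval t * Real.exp (-t ^ 2) : ℝ) : ℂ) / (z - (t : ℂ))

theorem integrable_eval_mul_exp_neg_mul_sq (p : ℝ[X]) {b : ℝ} (hb : 0 < b) :
    Integrable fun t : ℝ => p.eval t * Real.exp (-b * t ^ 2) := by
  induction p using Polynomial.induction_on' with
  | add p q hp hq =>
    simp only [eval_add, add_mul]
    exact hp.add hq
  | monomial n a =>
    have h := integrable_rpow_mul_exp_neg_mul_sq hb (s := (n : ℝ))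
      (by linarith [n.cast_nonneg (α := ℝ)])
    simpa [Real.rpow_natCast, mul_assoc] using h.const_mul a

theorem hasDerivAt_eval_mul_exp_neg_mul_sq (p : ℝ[X]) (b t : ℝ) :
    HasDerivAt (fun t : ℝ => p.eval t * Real.exp (-b * t ^ 2))
      ((derivative p - C (2 * b) * X * p).eval t * Real.exp (-b * t ^ 2)) t := by
  have h := (p.hasDerivAt t).mul (((hasDerivAt_pow 2 t).const_mul (-b)).exp)
  convert! h using 1
  simp
  ring

theorem integrable_gauss (p : ℝ[X]) :
    Integrable fun t : ℝ => p.eval t * Real.exp (-t ^ 2) := by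
  simpa using integrable_eval_mul_exp_neg_mul_sq p one_pos

theorem hasDerivAt_gauss (p : ℝ[X]) (t : ℝ) :
    HasDerivAt (fun t : ℝ => p.eval t * Real.exp (-t ^ 2))
      ((gaussDeriv p).eval t * Real.exp (-t ^ 2)) t := by
  simpa [gaussDeriv] using hasDerivAt_eval_mul_exp_neg_mul_sq p 1 t

theorem gaussInt_gaussDeriv (p : ℝ[X]) : gaussInt (gaussDeriv p) = 0 :=
  integral_eq_zero_of_hasDerivAt_of_integrable (hasDerivAt_gauss p)
    (integrable_gauss _) (integrable_gauss _)

theorem gaussInt_add (p q : ℝ[X]) : gaussInt (p + q) = gaussInt p + gaussInt q := by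
  simp only [gaussInt, eval_add, add_mul]
  exact integral_add (integrable_gauss p) (integrable_gauss q)

theorem gaussInt_C_mul (a : ℝ) (p : ℝ[X]) : gaussInt (C a * p) = a * gaussInt p := by
  simp only [gaussInt, eval_mul, eval_C, mul_assoc]
  exact integral_const_mul _ _

theorem gaussInt_X_mul_gaussDeriv (p : ℝ[X]) (k : ℕ) :
    gaussInt (X ^ (k + 1) * gaussDeriv p) = -((k : ℝ) + 1) * gaussInt (X ^ k * p) := by
  have h : gaussDeriv (X ^ (k + 1) * p) =
      C ((k : ℝ) + 1) * (X ^ k * p) + X ^ (k + 1) * gaussDeriv p := by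
    simp [gaussDeriv, derivative_mul]
    ring
  have h0 := gaussInt_gaussDeriv (X ^ (k + 1) * p)
  rw [h, gaussInt_add, gaussInt_C_mul] at h0
  linarith

theorem norm_inv_sub_ofReal_le {z : ℂ} {ε : ℝ} (hε : 0 < ε) (hz : ε ≤ |z.im|) (t : ℝ) :
    ‖(z - (t : ℂ))⁻¹‖ ≤ ε⁻¹ := by
  rw [norm_inv]
  refine inv_anti₀ hε (hz.trans ?_)
  simpa using Complex.abs_im_le_norm (z - (t : ℂ))

theorem sub_ofReal_ne_zero {z : ℂ} (hz : z.im ≠ 0) (t : ℝ) : z - (t : ℂ) ≠ 0 := by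
  intro h
  apply hz
  simpa using congrArg Complex.im h

theorem integrable_ofReal_div_sub {f : ℝ → ℝ} (hf : Integrable f) {z : ℂ} (hz : z.im ≠ 0) :
    Integrable fun t : ℝ => ((f t : ℝ) : ℂ) / (z - (t : ℂ)) := by
  simp only [div_eq_mul_inv]
  refine hf.ofReal.mul_bdd (c := |z.im|⁻¹) ?_ ?_
  · exact (by fun_prop : Measurable fun t : ℝ => (z - (t : ℂ))⁻¹).aestronglyMeasurable
  · exact Filter.Eventually.of_forall fun t =>
      norm_inv_sub_ofReal_le (abs_pos.2 hz) le_rfl t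

theorem integrable_ofReal_div_sub_sq {f : ℝ → ℝ} (hf : Integrable f) {z : ℂ} (hz : z.im ≠ 0) :
    Integrable fun t : ℝ => ((f t : ℝ) : ℂ) / (z - (t : ℂ)) ^ 2 := by
  simp only [div_eq_mul_inv]
  refine hf.ofReal.mul_bdd (c := (|z.im|⁻¹) ^ 2) ?_ ?_
  · exact (by fun_prop : Measurable fun t : ℝ => ((z - (t : ℂ)) ^ 2)⁻¹).aestronglyMeasurable
  · refine Filter.Eventually.of_forall fun t => ?_
    rw [← inv_pow, norm_pow]
    exact pow_le_pow_left₀ (norm_nonneg _) (norm_inv_sub_ofReal_le (abs_pos.2 hz) le_rfl t) 2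

theorem hasDerivAt_integral_div_sub {f : ℝ → ℝ} (hf : Integrable f) {z : ℂ} (hz : z.im ≠ 0) :
    HasDerivAt (fun w : ℂ => ∫ t : ℝ, ((f t : ℝ) : ℂ) / (w - (t : ℂ)))
      (∫ t : ℝ, -(((f t : ℝ) : ℂ) / (z - (t : ℂ)) ^ 2)) z := by
  have hε : 0 < |z.im| / 2 := by positivity
  have hs : {w : ℂ | |z.im| / 2 < |w.im|} ∈ nhds z := by
    refine (isOpen_lt continuous_const (by fun_prop)).mem_nhds ?_
    simpa using hz
  have hne : ∀ w ∈ {w : ℂ | |z.im| / 2 < |w.im|}, w.im ≠ 0 := fun w hw =>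
    abs_pos.1 (hε.trans hw)
  refine (hasDerivAt_integral_of_dominated_loc_of_deriv_le
    (bound := fun t => ‖f t‖ * ((|z.im| / 2)⁻¹) ^ 2)
    hs ?_ (integrable_ofReal_div_sub hf hz)
    (F' := fun w t => -(((f t : ℝ) : ℂ) / (w - (t : ℂ)) ^ 2))
    (integrable_ofReal_div_sub_sq hf hz).neg.aestronglyMeasurable ?_ ?_ ?_).2
  · filter_upwards [hs] with w hw
    exact (integrable_ofReal_div_sub hf (hne w hw)).aestronglyMeasurable
  · refine Filter.Eventually.of_forall fun t w hw => ?_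
    rw [norm_neg, div_eq_mul_inv, norm_mul, ← inv_pow, norm_pow, Complex.norm_real]
    gcongr
    exact norm_inv_sub_ofReal_le hε (le_of_lt hw) t
  · exact hf.norm.mul_const _
  · refine Filter.Eventually.of_forall fun t w hw => ?_
    have h := ((hasDerivAt_id w).sub_const (t : ℂ)).inv (sub_ofReal_ne_zero (hne w hw) t)
    convert! h.const_mul ((f t : ℝ) : ℂ) using 1
    simp
    ring

theorem hasDerivAt_gaussStieltjes (p : ℝ[X]) {z : ℂ} (hz : z.im ≠ 0) :
    HasDerivAt (gaussStieltjes p) (gaussStieltjes (gaussDeriv p) z) z := by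
  have h := hasDerivAt_integral_div_sub (integrable_gauss p) hz
  convert! h using 1
  have hd : ∀ t : ℝ, HasDerivAt
      (fun t : ℝ => ((p.eval t * Real.exp (-t ^ 2) : ℝ) : ℂ) / (z - (t : ℂ)))
      ((((gaussDeriv p).eval t * Real.exp (-t ^ 2) : ℝ) : ℂ) / (z - (t : ℂ)) +
        ((p.eval t * Real.exp (-t ^ 2) : ℝ) : ℂ) / (z - (t : ℂ)) ^ 2) t := by
    intro t
    have hz' := sub_ofReal_ne_zero hz t
    have h1 := (hasDerivAt_gauss p t).ofReal_comp
    have h2 := ((hasDerivAt_id t).ofReal_comp).const_sub z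
    convert! h1.div h2 hz' using 1
    simp
    field_simp
  have h0 := integral_eq_zero_of_hasDerivAt_of_integrable hd
    ((integrable_ofReal_div_sub (integrable_gauss _) hz).add
      (integrable_ofReal_div_sub_sq (integrable_gauss _) hz))
    (integrable_ofReal_div_sub (integrable_gauss _) hz)
  rw [integral_add (integrable_ofReal_div_sub (integrable_gauss _) hz)
      (integrable_ofReal_div_sub_sq (integrable_gauss _) hz)] at h0
  rw [integral_neg]
  exact eq_neg_of_add_eq_zero_left h0

theorem gaussStieltjes_add (p q : ℝ[X]) {z : ℂ} (hz : z.im ≠ 0) :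
    gaussStieltjes (p + q) z = gaussStieltjes p z + gaussStieltjes q z := by
  simp only [gaussStieltjes]
  rw [← integral_add (integrable_ofReal_div_sub (integrable_gauss p) hz)
    (integrable_ofReal_div_sub (integrable_gauss q) hz)]
  congr 1
  ext t
  simp
  ring

theorem gaussStieltjes_C_mul (a : ℝ) (p : ℝ[X]) (z : ℂ) :
    gaussStieltjes (C a * p) z = a * gaussStieltjes p z := by
  simp only [gaussStieltjes]
  rw [← integral_const_mul]
  congr 1
  ext t
  simp
  ring

theorem mul_gaussStieltjes (p : ℝ[X]) {z : ℂ} (hz : z.im ≠ 0) :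
    z * gaussStieltjes p z = gaussStieltjes (X * p) z + gaussInt p := by
  simp only [gaussStieltjes, gaussInt]
  have h := integral_add (integrable_ofReal_div_sub (integrable_gauss (X * p)) hz)
    (integrable_gauss p).ofReal
  rw [← integral_const_mul, ← integral_complex_ofReal]
  refine Eq.trans ?_ h
  congr 1
  ext t
  have := sub_ofReal_ne_zero hz t
  simp
  field_simp
  ring

/-- The polynomial underlying the GSE density, in terms of `u = H_{2N}`, `v = H_{2N-1}` and
`q = e^{x²/2} Q_{2N-1}`. -/
noncomputable def gsePoly (N : ℕ) (u v q : ℝ[X]) : ℝ[X] :=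
  4 * (N : ℝ[X]) * v ^ 2 - 2 * X * u * v + u ^ 2 + u * q

section Algebra

variable {N : ℕ} {u v q : ℝ[X]}

theorem gaussDeriv_gsePoly (hu : derivative u = 4 * (N : ℝ[X]) * v)
    (hv : derivative v = 2 * X * v - u) (hq : derivative q = X * q + v) :
    gaussDeriv (gsePoly N u v q) = -X * (u * q) + 4 * (N : ℝ[X]) * (v * q) - u * v := by
  simp [map_ofNat, gaussDeriv, gsePoly, derivative_mul, derivative_pow, hu, hv, hq]
  ring

theorem gaussDeriv_iterate_two_gsePoly (hu : derivative u = 4 * (N : ℝ[X]) * v)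
    (hv : derivative v = 2 * X * v - u) (hq : derivative q = X * q + v) :
    gaussDeriv^[2] (gsePoly N u v q) =
      (X ^ 2 - 4 * (N : ℝ[X]) - 1) * (u * q) - X * (u * v) + u ^ 2 := by
  rw [Function.iterate_succ_apply', Function.iterate_one, gaussDeriv_gsePoly hu hv hq]
  simp [gaussDeriv, derivative_mul, hu, hv, hq]
  ring

theorem gaussDeriv_iterate_three_gsePoly (hu : derivative u = 4 * (N : ℝ[X]) * v)
    (hv : derivative v = 2 * X * v - u) (hq : derivative q = X * q + v) :
    gaussDeriv^[3] (gsePoly N u v q) =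
      (-X ^ 3 + 4 * X * (N : ℝ[X]) + 3 * X) * (u * q) +
        (4 * X ^ 2 * (N : ℝ[X]) - 16 * (N : ℝ[X]) ^ 2 - 4 * (N : ℝ[X])) * (v * q) +
        (X ^ 2 + 4 * (N : ℝ[X]) - 2) * (u * v) - 4 * X * (N : ℝ[X]) * v ^ 2 - X * u ^ 2 := by
  rw [Function.iterate_succ_apply', gaussDeriv_iterate_two_gsePoly hu hv hq]
  simp [map_ofNat, gaussDeriv, derivative_mul, derivative_pow, hu, hv, hq]
  ring

theorem gaussDeriv_iterate_five_gsePoly (hu : derivative u = 4 * (N : ℝ[X]) * v)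
    (hv : derivative v = 2 * X * v - u) (hq : derivative q = X * q + v) :
    gaussDeriv^[5] (gsePoly N u v q) =
      5 * (X ^ 2 - 4 * (N : ℝ[X]) - 1) * gaussDeriv^[3] (gsePoly N u v q) -
        6 * X * gaussDeriv^[2] (gsePoly N u v q) +
        (-4 * X ^ 4 + (32 * (N : ℝ[X]) + 8) * X ^ 2 - 64 * (N : ℝ[X]) ^ 2 - 32 * (N : ℝ[X]) + 2) *
          gaussDeriv (gsePoly N u v q) +
        4 * (X ^ 3 - (4 * (N : ℝ[X]) + 1) * X) * gsePoly N u v q := by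
  have h4 : gaussDeriv^[4] (gsePoly N u v q) =
      (X ^ 4 - 8 * X ^ 2 * (N : ℝ[X]) - 6 * X ^ 2 + 16 * (N : ℝ[X]) ^ 2 + 8 * (N : ℝ[X]) + 3) *
          (u * q) +
        (-X ^ 3 + 4 * X * (N : ℝ[X]) + 5 * X) * (u * v) +
        (X ^ 2 - 4 * (N : ℝ[X]) + 1) * u ^ 2 +
        16 * X * (N : ℝ[X]) * (v * q) - 16 * (N : ℝ[X]) * v ^ 2 := by
    rw [Function.iterate_succ_apply', gaussDeriv_iterate_three_gsePoly hu hv hq]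
    simp [map_ofNat, gaussDeriv, derivative_mul, derivative_pow, hu, hv, hq]
    ring
  rw [Function.iterate_succ_apply', h4, gaussDeriv_iterate_three_gsePoly hu hv hq,
    gaussDeriv_iterate_two_gsePoly hu hv hq, gaussDeriv_gsePoly hu hv hq]
  simp [map_ofNat, gaussDeriv, gsePoly, derivative_mul, derivative_pow, hu, hv, hq]
  ring

theorem gaussInt_gsePoly (hu : derivative u = 4 * (N : ℝ[X]) * v)
    (hv : derivative v = 2 * X * v - u) (h0 : gaussInt (u * q) = 0) :
    gaussInt (gsePoly N u v q) = 4 * N * gaussInt (v ^ 2) := by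
  have h : C 2 * gsePoly N u v q = C (8 * (N : ℝ)) * v ^ 2 + (C 2 * (u * q) +
      gaussDeriv (-2 * X ^ 2 * (u * v) + 4 * (N : ℝ[X]) * X * v ^ 2 + X * u ^ 2 - u * v)) := by
    simp [map_ofNat, gaussDeriv, gsePoly, derivative_mul, derivative_pow, hu, hv]
    ring
  have h' := congrArg gaussInt h
  rw [gaussInt_add, gaussInt_add, gaussInt_C_mul, gaussInt_C_mul, gaussInt_C_mul,
    gaussInt_gaussDeriv, h0] at h'
  linarith

theorem gaussInt_X_mul_gsePoly (hu : derivative u = 4 * (N : ℝ[X]) * v)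
    (hv : derivative v = 2 * X * v - u) (hq : derivative q = X * q + v) :
    gaussInt (X * gsePoly N u v q) = 0 := by
  have h : C 6 * (X * gsePoly N u v q) =
      gaussDeriv (4 * (N : ℝ[X]) * v ^ 2 - u ^ 2 +
        (8 * (N : ℝ[X]) + 3) * (2 * X * (u * v) - 4 * (N : ℝ[X]) * v ^ 2 - u ^ 2) +
        (8 * (N : ℝ[X]) * X ^ 2 * v ^ 2 + 2 * X ^ 2 * u ^ 2 - 4 * X ^ 3 * (u * v)) +
        12 * (N : ℝ[X]) * q ^ 2 - 6 * u * q) := by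
    simp [map_ofNat, gaussDeriv, gsePoly, derivative_mul, derivative_pow, hu, hv, hq]
    ring
  have h' := congrArg gaussInt h
  rw [gaussInt_C_mul, gaussInt_gaussDeriv] at h'
  linarith

theorem gaussInt_X_sq_mul_gsePoly (hu : derivative u = 4 * (N : ℝ[X]) * v)
    (hv : derivative v = 2 * X * v - u) (hq : derivative q = X * q + v)
    (h0 : gaussInt (u * q) = 0) :
    gaussInt (X ^ 2 * gsePoly N u v q) = (4 * (N : ℝ) ^ 2 - 2 * N) * gaussInt (v ^ 2) := by
  have h : C 8 * (X ^ 2 * gsePoly N u v q) =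
      C (8 * (4 * (N : ℝ) ^ 2 - 2 * N)) * v ^ 2 + (C (8 + 32 * (N : ℝ)) * (u * q) +
      gaussDeriv (32 * (N : ℝ[X]) * v * q - 8 * X * u * q -
        4 * X ^ 4 * u * v + 8 * (N : ℝ[X]) * X ^ 3 * v ^ 2 + 2 * X ^ 3 * u ^ 2 +
        4 * (N : ℝ[X]) * X * v ^ 2 - X * u ^ 2 - u * v +
        (2 * (N : ℝ[X]) + 1) * (4 * X ^ 2 * u * v - 8 * (N : ℝ[X]) * X * v ^ 2 -
          2 * X * u ^ 2 - 2 * u * v))) := by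
    simp [map_ofNat, gaussDeriv, gsePoly, derivative_mul, derivative_pow, hu, hv, hq]
    ring
  have h' := congrArg gaussInt h
  rw [gaussInt_add, gaussInt_add, gaussInt_C_mul, gaussInt_C_mul, gaussInt_C_mul,
    gaussInt_gaussDeriv, h0] at h'
  linarith

end Algebra

/-- The physicists' Hermite polynomials as elements of `ℝ[X]`. -/
noncomputable def hermPoly : ℕ → ℝ[X]
  | 0 => 1
  | 1 => 2 * X
  | n + 2 => 2 * X * hermPoly (n + 1) - 2 * ((n : ℝ[X]) + 1) * hermPoly n

theorem eval_hermPoly (n : ℕ) (x : ℝ) : (hermPoly n).eval x = Hphys n x := by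
  induction n using hermPoly.induct with
  | case1 => simp [hermPoly, Hphys]
  | case2 => simp [hermPoly, Hphys]
  | case3 n ih1 ih2 => simp [hermPoly, Hphys, ih1, ih2]

theorem derivative_hermPoly_succ (n : ℕ) :
    derivative (hermPoly (n + 1)) = 2 * ((n : ℝ[X]) + 1) * hermPoly n := by
  induction n using hermPoly.induct with
  | case1 => simp [hermPoly]
  | case2 =>
    simp [hermPoly]
    ring
  | case3 n ih1 ih2 =>
    rw [hermPoly, derivative_sub, derivative_mul, ih1]
    simp only [derivative_mul, ih2]
    rw [hermPoly]
    simp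
    ring

theorem derivative_hermPoly (n : ℕ) :
    derivative (hermPoly n) = 2 * X * hermPoly n - hermPoly (n + 1) := by
  cases n with
  | zero => simp [hermPoly]
  | succ n =>
    rw [derivative_hermPoly_succ, hermPoly]
    ring

theorem deriv_Hphys (n : ℕ) (x : ℝ) : deriv (Hphys n) x = (derivative (hermPoly n)).eval x := by
  rw [← Polynomial.deriv]
  congr 1
  ext y
  exact (eval_hermPoly n y).symm

theorem gaussInt_hermPoly_succ_sq (n : ℕ) :
    gaussInt (hermPoly (n + 1) ^ 2) = 2 * ((n : ℝ) + 1) * gaussInt (hermPoly n ^ 2) := by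
  have h : hermPoly (n + 1) ^ 2 = C (2 * ((n : ℝ) + 1)) * hermPoly n ^ 2 +
      C (-1) * gaussDeriv (hermPoly (n + 1) * hermPoly n) := by
    rw [gaussDeriv, derivative_mul, derivative_hermPoly_succ, derivative_hermPoly n]
    simp [map_ofNat]
    ring
  rw [h, gaussInt_add, gaussInt_C_mul, gaussInt_C_mul, gaussInt_gaussDeriv]
  ring

theorem gaussInt_hermPoly_sq (n : ℕ) :
    gaussInt (hermPoly n ^ 2) = Real.sqrt Real.pi * 2 ^ n * (n ! : ℝ) := by
  induction n with
  | zero => simpa [gaussInt, hermPoly] using integral_gaussian 1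
  | succ n ih =>
    rw [gaussInt_hermPoly_succ_sq, ih, Nat.factorial_succ]
    push_cast
    ring

/-- The polynomials with `Q_{2N-1}(x) = q_N(x) e^{-x²/2}` for `N ≥ 1`, and `q_0 = 0`. -/
noncomputable def oddPrimitive : ℕ → ℝ[X]
  | 0 => 0
  | N + 1 => 4 * (N : ℝ[X]) * oddPrimitive N - 2 * hermPoly (2 * N)

theorem derivative_oddPrimitive_succ (N : ℕ) :
    derivative (oddPrimitive (N + 1)) = X * oddPrimitive (N + 1) + hermPoly (2 * N + 1) := by
  induction N with
  | zero =>
    simp [oddPrimitive, hermPoly]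
    ring
  | succ N ih =>
    have h1 : derivative (hermPoly (2 * (N + 1))) = _ := derivative_hermPoly_succ (2 * N + 1)
    have h2 := derivative_hermPoly (2 * (N + 1))
    rw [oddPrimitive, derivative_sub, derivative_mul, ih]
    simp only [derivative_mul, derivative_natCast, derivative_ofNat]
    push_cast at *
    linear_combination -h1 - h2

theorem gaussInt_hermPoly_mul_oddPrimitive (N : ℕ) :
    gaussInt (hermPoly (2 * N) * oddPrimitive N) = 0 := by
  induction N with
  | zero => simp [oddPrimitive, gaussInt]
  | succ N ih =>
    have h : hermPoly (2 * (N + 1)) * oddPrimitive (N + 1) =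
        C (8 * (N : ℝ) * (2 * N + 1)) * (hermPoly (2 * N) * oddPrimitive N) +
        (C (-4 * (2 * (N : ℝ) + 1)) * hermPoly (2 * N) ^ 2 +
        (C 2 * hermPoly (2 * N + 1) ^ 2 +
        C (-2) * gaussDeriv (hermPoly (2 * N + 1) * oddPrimitive (N + 1)))) := by
      have h1 : hermPoly (2 * (N + 1)) = _ := hermPoly.eq_3 (2 * N)
      have h2 := derivative_hermPoly_succ (2 * N)
      rw [gaussDeriv, derivative_mul, derivative_oddPrimitive_succ, h2, h1, oddPrimitive]
      simp [map_ofNat]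
      ring
    rw [h, gaussInt_add, gaussInt_add, gaussInt_add, gaussInt_C_mul, gaussInt_C_mul,
      gaussInt_C_mul, gaussInt_C_mul, ih, gaussInt_gaussDeriv, gaussInt_hermPoly_succ_sq]
    push_cast
    ring

theorem Qfun_eq (N : ℕ) (x : ℝ) :
    Qfun (2 * N + 1) x = (oddPrimitive (N + 1)).eval x * Real.exp (-x ^ 2 / 2) := by
  have hd : ∀ t : ℝ, HasDerivAt
      (fun t : ℝ => (oddPrimitive (N + 1)).eval t * Real.exp (-(1 / 2 : ℝ) * t ^ 2))
      ((hermPoly (2 * N + 1)).eval t * Real.exp (-(1 / 2 : ℝ) * t ^ 2)) t := by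
    intro t
    have h := hasDerivAt_eval_mul_exp_neg_mul_sq (oddPrimitive (N + 1)) (1 / 2) t
    rw [derivative_oddPrimitive_succ] at h
    simpa using h
  have hi := fun p : ℝ[X] => (integrable_eval_mul_exp_neg_mul_sq p
    (show (0 : ℝ) < 1 / 2 by norm_num)).integrableOn (s := Set.Iic x)
  have h := integral_Iic_of_hasDerivAt_of_tendsto' (a := x) (fun t _ => hd t) (hi _)
    (tendsto_zero_of_hasDerivAt_of_integrableOn_Iic (a := x) (fun t _ => hd t) (hi _) (hi _))
  have he : ∀ t : ℝ, -t ^ 2 / 2 = -(1 / 2 : ℝ) * t ^ 2 := fun t => by ring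
  simp only [Qfun, he, ← eval_hermPoly]
  simpa [mul_comm] using h

theorem gseDensity_succ (N : ℕ) (x : ℝ) :
    gseDensity (N + 1) x = (Bconst (N + 1))⁻¹ *
      ((gsePoly (N + 1) (hermPoly (2 * (N + 1))) (hermPoly (2 * N + 1))
        (oddPrimitive (N + 1))).eval x * Real.exp (-x ^ 2)) := by
  have h1 : derivative (hermPoly (2 * (N + 1))) = _ := derivative_hermPoly_succ (2 * N + 1)
  have h2 := derivative_hermPoly (2 * N + 1)
  have he : Real.exp (-x ^ 2) = Real.exp (-x ^ 2 / 2) * Real.exp (-x ^ 2 / 2) := by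
    rw [← Real.exp_add]
    ring_nf
  rw [gseDensity, show 2 * (N + 1) - 1 = 2 * N + 1 by omega, Qfun_eq, deriv_Hphys, deriv_Hphys,
    h1, h2, ← eval_hermPoly, ← eval_hermPoly, he]
  congr 1
  simp [gsePoly, Nat.mul_add]
  ring

theorem gaussStieltjes_X_pow_succ_mul (k : ℕ) (p : ℝ[X]) {z : ℂ} (hz : z.im ≠ 0) :
    gaussStieltjes (X ^ (k + 1) * p) z =
      z * gaussStieltjes (X ^ k * p) z - gaussInt (X ^ k * p) := by
  rw [mul_gaussStieltjes _ hz, _root_.pow_succ', mul_assoc, add_sub_cancel_right]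

theorem gaussStieltjes_ode {N : ℕ} {b : ℝ} {p : ℝ[X]}
    (hp : gaussDeriv^[5] p =
      5 * (X ^ 2 - 4 * (N : ℝ[X]) - 1) * gaussDeriv^[3] p - 6 * X * gaussDeriv^[2] p +
        (-4 * X ^ 4 + (32 * (N : ℝ[X]) + 8) * X ^ 2 - 64 * (N : ℝ[X]) ^ 2 - 32 * (N : ℝ[X]) + 2) *
          gaussDeriv p +
        4 * (X ^ 3 - (4 * (N : ℝ[X]) + 1) * X) * p)
    (h0 : gaussInt p = N * b) (h1 : gaussInt (X * p) = 0)
    (h2 : gaussInt (X ^ 2 * p) = ((N : ℝ) ^ 2 - N / 2) * b) {z : ℂ} (hz : z.im ≠ 0) :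
    -gaussStieltjes (gaussDeriv^[5] p) z +
        5 * (z ^ 2 - 4 * N - 1) * gaussStieltjes (gaussDeriv^[3] p) z -
        6 * z * gaussStieltjes (gaussDeriv^[2] p) z +
        (-4 * z ^ 4 + (32 * N + 8) * z ^ 2 - 64 * N ^ 2 - 32 * N + 2) *
          gaussStieltjes (gaussDeriv p) z +
        4 * (z ^ 3 - (4 * N + 1) * z) * gaussStieltjes p z =
      4 * b * (2 * N * (z ^ 2 - 4 * N) - 5 * N) := by
  have hp' : gaussDeriv^[5] p = C 5 * (X ^ 2 * gaussDeriv^[3] p) +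
      (C (-(20 * (N : ℝ) + 5)) * gaussDeriv^[3] p + (C (-6) * (X ^ 1 * gaussDeriv^[2] p) +
      (C (-4) * (X ^ 4 * gaussDeriv p) + (C (32 * (N : ℝ) + 8) * (X ^ 2 * gaussDeriv p) +
      (C (-64 * (N : ℝ) ^ 2 - 32 * N + 2) * gaussDeriv p +
      (C 4 * (X ^ 3 * p) + C (-4 * (4 * (N : ℝ) + 1)) * (X ^ 1 * p))))))) := by
    rw [hp]
    simp [map_ofNat]
    ring
  have e2 : gaussDeriv^[2] p = gaussDeriv (gaussDeriv p) := rfl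
  have e3 : gaussDeriv^[3] p = gaussDeriv (gaussDeriv (gaussDeriv p)) := rfl
  have m1 := gaussInt_X_mul_gaussDeriv p 0
  have m2 := gaussInt_X_mul_gaussDeriv p 1
  have m3 := gaussInt_X_mul_gaussDeriv p 2
  have m4 := gaussInt_X_mul_gaussDeriv (gaussDeriv (gaussDeriv p)) 0
  have x0 : ∀ r : ℝ[X], X ^ 0 * r = r := fun r => by simp
  simp only [x0, gaussInt_gaussDeriv, pow_one, h0, h1, h2, Nat.reduceAdd] at m1 m2 m3 m4
  rw [hp']
  simp only [gaussStieltjes_add _ _ hz, gaussStieltjes_C_mul]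
  have y1 := fun r => gaussStieltjes_X_pow_succ_mul 0 r hz
  have y2 := fun r => gaussStieltjes_X_pow_succ_mul 1 r hz
  have y3 := fun r => gaussStieltjes_X_pow_succ_mul 2 r hz
  have y4 := fun r => gaussStieltjes_X_pow_succ_mul 3 r hz
  simp only [x0, Nat.reduceAdd] at y1 y2 y3 y4
  simp only [y4, y3, y2, y1, e2, e3]
  simp only [gaussInt_gaussDeriv, pow_one, h0, h1, h2, m1, m2, m3, m4]
  push_cast
  ring

theorem iteratedDeriv_eq_of_hasDerivAt {U : Set ℂ} (hU : IsOpen U) {F : ℕ → ℂ → ℂ}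
    (hF : ∀ k, ∀ z ∈ U, HasDerivAt (F k) (F (k + 1) z) z) (k : ℕ) {z : ℂ} (hz : z ∈ U) :
    iteratedDeriv k (F 0) z = F k z := by
  induction k generalizing z with
  | zero => simp
  | succ k ih =>
    have h : iteratedDeriv k (F 0) =ᶠ[nhds z] F k :=
      Filter.eventually_of_mem (hU.mem_nhds hz) fun w hw => ih hw
    rw [iteratedDeriv_succ, h.deriv_eq, (hF k z hz).deriv]

theorem gseResolvent_eq {N : ℕ} {g : ℝ} (hs : 0 < Real.sqrt ((N : ℝ) / g)) {p : ℝ[X]}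
    {b : ℝ} (h : ∀ x, gseDensity N x = b⁻¹ * (p.eval x * Real.exp (-x ^ 2))) (z : ℂ) :
    gseResolvent N g z = (Real.sqrt ((N : ℝ) / g) : ℂ) * ((b : ℂ)⁻¹ *
      gaussStieltjes p ((Real.sqrt ((N : ℝ) / g) : ℂ) * z)) := by
  set s := Real.sqrt ((N : ℝ) / g) with hsd
  have hs' : (s : ℂ) ≠ 0 := Complex.ofReal_ne_zero.2 hs.ne'
  have hi := Measure.integral_comp_mul_left (fun t : ℝ =>
    ((p.eval t * Real.exp (-t ^ 2) : ℝ) : ℂ) / ((s : ℂ) * z - (t : ℂ))) s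
  rw [abs_of_pos (inv_pos.2 hs)] at hi
  have hS : gaussStieltjes p ((s : ℂ) * z) = (s : ℂ) * ∫ t : ℝ,
      ((p.eval (s * t) * Real.exp (-(s * t) ^ 2) : ℝ) : ℂ) /
        ((s : ℂ) * z - ((s * t : ℝ) : ℂ)) := by
    rw [hi, Complex.real_smul, Complex.ofReal_inv, mul_inv_cancel_left₀ hs', gaussStieltjes]
  rw [hS, gseResolvent, ← integral_const_mul, ← integral_const_mul, ← integral_const_mul]
  congr 1
  ext t
  simp only [gseDensityScaled, ← hsd, h]
  push_cast
  rw [← mul_sub]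
  field_simp

theorem iteratedDeriv_gseResolvent {N : ℕ} {g : ℝ} (hs : 0 < Real.sqrt ((N : ℝ) / g)) {p : ℝ[X]}
    {b : ℝ} (h : ∀ x, gseDensity N x = b⁻¹ * (p.eval x * Real.exp (-x ^ 2))) (k : ℕ)
    {z : ℂ} (hz : z.im ≠ 0) :
    iteratedDeriv k (gseResolvent N g) z =
      (Real.sqrt ((N : ℝ) / g) : ℂ) ^ (k + 1) * ((b : ℂ)⁻¹ *
        gaussStieltjes (gaussDeriv^[k] p) ((Real.sqrt ((N : ℝ) / g) : ℂ) * z)) := by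
  set s := Real.sqrt ((N : ℝ) / g) with hsd
  have h0 : gseResolvent N g = fun z => (s : ℂ) ^ (0 + 1) * ((b : ℂ)⁻¹ *
      gaussStieltjes (gaussDeriv^[0] p) ((s : ℂ) * z)) := by
    ext z
    rw [zero_add, pow_one, Function.iterate_zero_apply, gseResolvent_eq hs h]
  rw [h0]
  refine iteratedDeriv_eq_of_hasDerivAt (U := {z : ℂ | z.im ≠ 0})
    (isOpen_ne_fun Complex.continuous_im continuous_const)
    (F := fun k z => (s : ℂ) ^ (k + 1) * ((b : ℂ)⁻¹ *
      gaussStieltjes (gaussDeriv^[k] p) ((s : ℂ) * z))) (fun k w hw => ?_) k hz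
  have hw' : ((s : ℂ) * w).im ≠ 0 := by
    simpa using ⟨hs.ne', hw⟩
  have hd := ((hasDerivAt_gaussStieltjes (gaussDeriv^[k] p) hw').comp w
    ((hasDerivAt_id w).const_mul (s : ℂ))).const_mul ((b : ℂ)⁻¹)
  convert! hd.const_mul ((s : ℂ) ^ (k + 1)) using 1
  rw [Function.iterate_succ_apply']
  ring

theorem Bconst_succ (N : ℕ) :
    Bconst (N + 1) = 4 * gaussInt (hermPoly (2 * N + 1) ^ 2) := by
  rw [gaussInt_hermPoly_sq, Bconst, show 2 * (N + 1) - 1 = 2 * N + 1 by omega]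
  ring

theorem Bconst_pos (N : ℕ) : 0 < Bconst N := by
  have := Real.pi_pos
  rw [Bconst]
  positivity

/-- The GSE resolvent satisfies the fifth order inhomogeneous ODE
`−(1/4)(g⁴/N⁴)W⁽⁵⁾ + 5((1/4)z²−(g/N)(N+1/4))(g²/N²)W''' − (3/2)(g²/N²)zW''
  + (−z⁴+(8N+2)(g/N)z²+(−16N²−8N+1/2)(g²/N²))W' + z(z²−(4N+1)(g/N))W
  = 2N(z²−4g)−5g` off the real axis. -/
theorem gseResolvent_ode (N : ℕ) (hN : 1 ≤ N) (g : ℝ) (hg : 0 < g)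
    (z : ℂ) (hz : z.im ≠ 0) :
    -(1 / 4) * ((g : ℂ) ^ 4 / (N : ℂ) ^ 4) * iteratedDeriv 5 (gseResolvent N g) z +
        5 * ((1 / 4) * z ^ 2 - ((g : ℂ) / (N : ℂ)) * ((N : ℂ) + 1 / 4)) *
          ((g : ℂ) ^ 2 / (N : ℂ) ^ 2) * iteratedDeriv 3 (gseResolvent N g) z -
        (3 / 2) * ((g : ℂ) ^ 2 / (N : ℂ) ^ 2) * z * iteratedDeriv 2 (gseResolvent N g) z +
        (-z ^ 4 + (8 * (N : ℂ) + 2) * ((g : ℂ) / (N : ℂ)) * z ^ 2 +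
            (-16 * (N : ℂ) ^ 2 - 8 * (N : ℂ) + 1 / 2) * ((g : ℂ) ^ 2 / (N : ℂ) ^ 2)) *
          deriv (gseResolvent N g) z +
        z * (z ^ 2 - (4 * (N : ℂ) + 1) * ((g : ℂ) / (N : ℂ))) * gseResolvent N g z =
      2 * (N : ℂ) * (z ^ 2 - 4 * (g : ℂ)) - 5 * (g : ℂ) := by
  obtain ⟨M, rfl⟩ : ∃ M, N = M + 1 := ⟨N - 1, by omega⟩
  have hN0 : (0 : ℝ) < ((M + 1 : ℕ) : ℝ) := by positivity
  have hs : 0 < Real.sqrt (((M + 1 : ℕ) : ℝ) / g) := Real.sqrt_pos.2 (div_pos hN0 hg)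
  have hu : derivative (hermPoly (2 * (M + 1))) =
      4 * ((M + 1 : ℕ) : ℝ[X]) * hermPoly (2 * M + 1) := by
    rw [show 2 * (M + 1) = 2 * M + 1 + 1 by ring, derivative_hermPoly_succ]
    push_cast
    ring
  have hv := derivative_hermPoly (2 * M + 1)
  have hq := derivative_oddPrimitive_succ M
  have h0 := gaussInt_hermPoly_mul_oddPrimitive (M + 1)
  have hB := Bconst_succ M
  have hB0 : ((Bconst (M + 1) : ℝ) : ℂ) ≠ 0 := Complex.ofReal_ne_zero.2 (Bconst_pos _).ne'
  have hW := fun k => iteratedDeriv_gseResolvent hs (gseDensity_succ M) k hz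
  have hw : ((Real.sqrt (((M + 1 : ℕ) : ℝ) / g) : ℂ) * z).im ≠ 0 := by
    rw [Complex.im_ofReal_mul]
    exact mul_ne_zero hs.ne' hz
  have hode := gaussStieltjes_ode (b := Bconst (M + 1))
    (gaussDeriv_iterate_five_gsePoly hu hv hq)
    (by rw [gaussInt_gsePoly hu hv h0, hB]; ring)
    (gaussInt_X_mul_gsePoly hu hv hq)
    (by rw [gaussInt_X_sq_mul_gsePoly hu hv hq h0, hB]; ring) hw
  have hsq : (Real.sqrt (((M + 1 : ℕ) : ℝ) / g) : ℂ) ^ 2 * g = ((M + 1 : ℕ) : ℂ) := by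
    rw [← Complex.ofReal_pow, Real.sq_sqrt (div_pos hN0 hg).le, ← Complex.ofReal_mul,
      div_mul_cancel₀ _ hg.ne', Complex.ofReal_natCast]
  have hW0 := hW 0
  have hW1 := hW 1
  rw [iteratedDeriv_zero] at hW0
  rw [iteratedDeriv_one] at hW1
  rw [hW0, hW1, hW 2, hW 3, hW 5]
  generalize gsePoly _ _ _ _ = p at hode ⊢
  have hs0 : (Real.sqrt (((M + 1 : ℕ) : ℝ) / g) : ℂ) ≠ 0 := Complex.ofReal_ne_zero.2 hs.ne'
  have hn0 : ((M + 1 : ℕ) : ℂ) ≠ 0 := Nat.cast_ne_zero.2 (Nat.succ_ne_zero M)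
  generalize (Real.sqrt (((M + 1 : ℕ) : ℝ) / g) : ℂ) = s at *
  generalize ((M + 1 : ℕ) : ℂ) = n at *
  have hg' : (g : ℂ) = n / s ^ 2 := by
    rw [← hsq]
    field_simp
  rw [hg']
  simp only [Function.iterate_zero, id, Function.iterate_one]
  generalize ((Bconst (M + 1) : ℝ) : ℂ) = b at *
  linear_combination (norm := skip) (1 / (4 * b * s ^ 2)) * hode
  field_simp
  ring
end

section
/- Let N ≥ 1 be an integer and let m_{2p} = ∫_ℝ x^{2p}·ρ_N(x) dx denote the even moments of the unscaled GSE eigenvalue density. Then m_0 = N, m_2 = N·(N − 1/2), and for every integer p ≥ 4, (p+1)·m_{2p} = (1/2)·(4p−1)·(4N+1)·m_{2p−2} + (1/4)·(2p−3)·(10p² − 9p − 32N² − 16N)·m_{2p−4} − (5/8)·(2p−3)·(2p−4)·(2p−5)·(4N+1)·m_{2p−6} − (1/8)·(2p−3)·(2p−4)·(2p−5)·(2p−6)·(2p−7)·m_{2p−8}. -/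
open Nat MeasureTheory

/-- The even moments `m_{2p} = ∫_ℝ x^{2p} ρ_N(x) dx` of the unscaled GSE
eigenvalue density. -/
noncomputable def gseMoment (N p : ℕ) : ℝ :=
  ∫ x : ℝ, x ^ (2 * p) * gseDensity N x


open Polynomial in
/-- Continuous functions dominated by a polynomial. -/
def PolyBounded (f : ℝ → ℝ) : Prop :=
  Continuous f ∧ ∃ P : ℝ[X], ∀ x, |f x| ≤ P.eval x

lemma PolyBounded.mul {f g : ℝ → ℝ} (hf : PolyBounded f) (hg : PolyBounded g) :
    PolyBounded (fun x => f x * g x) := by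
  obtain ⟨cf, P, hP⟩ := hf
  obtain ⟨cg, Q, hQ⟩ := hg
  refine ⟨cf.mul cg, P * Q, fun x => ?_⟩
  rw [abs_mul, Polynomial.eval_mul]
  exact mul_le_mul (hP x) (hQ x) (abs_nonneg _) ((abs_nonneg _).trans (hP x))

lemma PolyBounded.sub {f g : ℝ → ℝ} (hf : PolyBounded f) (hg : PolyBounded g) :
    PolyBounded (fun x => f x - g x) := by
  obtain ⟨cf, P, hP⟩ := hf
  obtain ⟨cg, Q, hQ⟩ := hg
  refine ⟨cf.sub cg, P + Q, fun x => ?_⟩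
  rw [Polynomial.eval_add]
  exact (abs_sub _ _).trans (add_le_add (hP x) (hQ x))

lemma polyBounded_of_abs_le {f : ℝ → ℝ} (hf : Continuous f) (c : ℝ) (h : ∀ x, |f x| ≤ c) :
    PolyBounded f :=
  ⟨hf, Polynomial.C c, fun x => by simpa using h x⟩

lemma polyBounded_const (c : ℝ) : PolyBounded (fun _ => c) :=
  polyBounded_of_abs_le continuous_const |c| fun _ => le_rfl

lemma polyBounded_id : PolyBounded (fun x => x) := by
  refine ⟨continuous_id, 1 + Polynomial.X ^ 2, fun x => ?_⟩
  simp only [Polynomial.eval_add, Polynomial.eval_one, Polynomial.eval_pow, Polynomial.eval_X]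
  rw [abs_le]
  constructor <;> nlinarith [sq_nonneg (x - 1), sq_nonneg (x + 1)]

lemma polyBounded_pow (k : ℕ) : PolyBounded (fun x => x ^ k) := by
  induction k with
  | zero => simpa using polyBounded_const 1
  | succ k ih => simpa only [pow_succ] using ih.mul polyBounded_id

lemma polyBounded_Hphys (n : ℕ) : PolyBounded (Hphys n) := by
  induction n using Nat.twoStepInduction with
  | zero => exact polyBounded_const 1
  | one => exact (polyBounded_const 2).mul polyBounded_id
  | more n h0 h1 =>
    exact (((polyBounded_const 2).mul polyBounded_id).mul h1).sub
      ((polyBounded_const (2 * ((n : ℝ) + 1))).mul h0)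

lemma integrable_polynomial_mul_gaussian (P : Polynomial ℝ) :
    Integrable (fun x : ℝ => Real.exp (-x ^ 2 / 2) * P.eval x) := by
  induction P using Polynomial.induction_on' with
  | add P Q hP hQ =>
    simp only [Polynomial.eval_add, mul_add]
    exact hP.add hQ
  | monomial k a =>
    have h := (integrable_rpow_mul_exp_neg_mul_sq (b := 1 / 2) (by norm_num)
      (s := k) (by linarith [k.cast_nonneg (α := ℝ)])).const_mul a
    refine h.congr (Filter.Eventually.of_forall fun x => ?_)
    simp only [Real.rpow_natCast, Polynomial.eval_monomial]
    rw [show -(1 / 2) * x ^ 2 = -x ^ 2 / 2 by ring]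
    ring

lemma PolyBounded.integrable_gaussian_mul {f : ℝ → ℝ} (hf : PolyBounded f) :
    Integrable (fun x : ℝ => Real.exp (-x ^ 2 / 2) * f x) := by
  obtain ⟨cf, P, hP⟩ := hf
  refine (integrable_polynomial_mul_gaussian P).mono' (by fun_prop)
    (Filter.Eventually.of_forall fun x => ?_)
  rw [Real.norm_eq_abs, abs_mul, abs_of_pos (Real.exp_pos _)]
  exact mul_le_mul_of_nonneg_left (hP x) (Real.exp_pos _).le

/-- The Hermite function `e^{−x²/2} H_n(x)`. -/
noncomputable def hermiteFn (n : ℕ) (x : ℝ) : ℝ := Real.exp (-x ^ 2 / 2) * Hphys n x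

lemma polyBounded_hermiteFn (n : ℕ) : PolyBounded (hermiteFn n) := by
  refine (polyBounded_of_abs_le (by fun_prop) 1 fun x => ?_).mul (polyBounded_Hphys n)
  rw [abs_of_pos (Real.exp_pos _), Real.exp_le_one_iff]
  nlinarith [sq_nonneg x]

lemma integrable_hermiteFn (n : ℕ) : Integrable (hermiteFn n) :=
  (polyBounded_Hphys n).integrable_gaussian_mul

lemma hasDerivAt_Hphys (n : ℕ) :
    (∀ x, HasDerivAt (Hphys n) (2 * x * Hphys n x - Hphys (n + 1) x) x) ∧
      ∀ x, HasDerivAt (Hphys (n + 1)) (2 * ((n : ℝ) + 1) * Hphys n x) x := by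
  have key : ∀ n : ℕ, ∀ x, HasDerivAt (Hphys (n + 1)) (2 * ((n : ℝ) + 1) * Hphys n x) x →
      HasDerivAt (Hphys (n + 1)) (2 * x * Hphys (n + 1) x - Hphys (n + 2) x) x := by
    intro n x h
    convert h using 1
    simp only [Hphys]
    ring
  have h1 : ∀ n : ℕ, ∀ x, HasDerivAt (Hphys (n + 1)) (2 * ((n : ℝ) + 1) * Hphys n x) x := by
    intro n
    induction n using Nat.twoStepInduction with
    | zero =>
      intro x
      simpa [Hphys] using (hasDerivAt_id x).const_mul 2
    | one =>
      intro x
      have h := ((((hasDerivAt_id x).const_mul 2).mul ((hasDerivAt_id x).const_mul 2)).sub_const 2)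
      refine (h.congr_of_eventuallyEq (Filter.Eventually.of_forall fun y => ?_)).congr_deriv ?_
      · simp [Hphys]
      · simp [Hphys]; ring
    | more n ih0 ih1 =>
      intro x
      have h := (((hasDerivAt_id x).const_mul 2).mul (ih1 x)).sub
        ((ih0 x).const_mul (2 * (((n + 1 : ℕ) : ℝ) + 1)))
      refine (h.congr_of_eventuallyEq (Filter.Eventually.of_forall fun y => ?_)).congr_deriv ?_
      · simp [Hphys]
      · simp only [Hphys, id]
        push_cast
        ring
  refine ⟨fun x => ?_, h1 n⟩
  cases n with
  | zero => simpa [Hphys] using hasDerivAt_const x (1 : ℝ)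
  | succ n => exact key n x (h1 n x)

lemma hasDerivAt_exp_neg_sq_half (x : ℝ) :
    HasDerivAt (fun y : ℝ => Real.exp (-y ^ 2 / 2)) (-x * Real.exp (-x ^ 2 / 2)) x := by
  have h := (((hasDerivAt_pow 2 x).neg).div_const 2).exp
  refine h.congr_deriv ?_
  simp
  ring

lemma hasDerivAt_hermiteFn_up (n : ℕ) (x : ℝ) :
    HasDerivAt (hermiteFn n) (x * hermiteFn n x - hermiteFn (n + 1) x) x := by
  refine ((hasDerivAt_exp_neg_sq_half x).mul ((hasDerivAt_Hphys n).1 x)).congr_deriv ?_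
  simp only [hermiteFn]
  ring

lemma hasDerivAt_hermiteFn_down (n : ℕ) (x : ℝ) :
    HasDerivAt (hermiteFn (n + 1))
      (-x * hermiteFn (n + 1) x + 2 * ((n : ℝ) + 1) * hermiteFn n x) x := by
  refine ((hasDerivAt_exp_neg_sq_half x).mul ((hasDerivAt_Hphys n).2 x)).congr_deriv ?_
  simp only [hermiteFn]
  ring

lemma Qfun_eq_s18 (n : ℕ) (x : ℝ) : Qfun n x = ∫ t in Set.Iic x, hermiteFn n t := rfl

lemma hasDerivAt_Qfun (n : ℕ) (x : ℝ) : HasDerivAt (Qfun n) (hermiteFn n x) x := by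
  have hc := (polyBounded_hermiteFn n).1
  have hi := fun a : ℝ => (integrable_hermiteFn n).integrableOn (s := Set.Iic a)
  have h := (intervalIntegral.integral_hasDerivAt_right (hc.intervalIntegrable 0 x)
    hc.stronglyMeasurable.stronglyMeasurableAtFilter hc.continuousAt).add_const (Qfun n 0)
  refine h.congr_of_eventuallyEq (Filter.Eventually.of_forall fun y => ?_)
  simp only [Qfun_eq_s18, ← intervalIntegral.integral_Iic_sub_Iic (hi 0) (hi y), sub_add_cancel]

lemma polyBounded_Qfun (n : ℕ) : PolyBounded (Qfun n) := by
  refine polyBounded_of_abs_le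
    (continuous_iff_continuousAt.2 fun x => (hasDerivAt_Qfun n x).continuousAt)
    (∫ t, |hermiteFn n t|) fun x => ?_
  rw [Qfun_eq_s18]
  exact (abs_integral_le_integral_abs).trans
    (setIntegral_le_integral (integrable_hermiteFn n).abs
      (Filter.Eventually.of_forall fun t => abs_nonneg _))

lemma tendsto_hermiteFn_atBot (n : ℕ) :
    Filter.Tendsto (hermiteFn n) Filter.atBot (nhds 0) := by
  have hd : Integrable (fun x => x * hermiteFn n x - hermiteFn (n + 1) x) := by
    refine Integrable.sub ?_ (integrable_hermiteFn _)
    refine (polyBounded_id.mul (polyBounded_Hphys n)).integrable_gaussian_mul.congr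
      (Filter.Eventually.of_forall fun x => ?_)
    simp only [hermiteFn]
    ring
  exact tendsto_zero_of_hasDerivAt_of_integrableOn_Iic (a := 0)
    (fun x _ => hasDerivAt_hermiteFn_up n x) hd.integrableOn (integrable_hermiteFn n).integrableOn

lemma Qfun_one (x : ℝ) : Qfun 1 x = -2 * hermiteFn 0 x := by
  have hd : ∀ y ∈ Set.Iic x, HasDerivAt (fun z => -2 * hermiteFn 0 z) (hermiteFn 1 y) y := by
    intro y _
    refine ((hasDerivAt_hermiteFn_up 0 y).const_mul (-2)).congr_deriv ?_
    simp only [hermiteFn, Hphys]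
    ring
  have ht := (tendsto_hermiteFn_atBot 0).const_mul (-2)
  rw [Qfun_eq_s18, integral_Iic_of_hasDerivAt_of_tendsto' hd (integrable_hermiteFn 1).integrableOn ht]
  ring

lemma Qfun_add_two (n : ℕ) (x : ℝ) :
    Qfun (n + 2) x = 2 * ((n : ℝ) + 1) * Qfun n x - 2 * hermiteFn (n + 1) x := by
  have hd : ∀ y ∈ Set.Iic x, HasDerivAt (fun z => 2 * hermiteFn (n + 1) z)
      (2 * ((n : ℝ) + 1) * hermiteFn n y - hermiteFn (n + 2) y) y := by
    intro y _
    refine ((hasDerivAt_hermiteFn_up (n + 1) y).const_mul 2).congr_deriv ?_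
    simp only [hermiteFn, Hphys]
    ring
  have i0 := ((integrable_hermiteFn n).const_mul (2 * ((n : ℝ) + 1))).integrableOn (s := Set.Iic x)
  have i2 := (integrable_hermiteFn (n + 2)).integrableOn (s := Set.Iic x)
  have h := integral_Iic_of_hasDerivAt_of_tendsto' hd (i0.sub i2)
    ((tendsto_hermiteFn_atBot (n + 1)).const_mul 2)
  rw [integral_sub i0 i2, integral_const_mul, ← Qfun_eq_s18, ← Qfun_eq_s18] at h
  linarith

/-- The product of a Hermite function and `g` has finite moments when `g` is polynomially bounded. -/
lemma integrable_pow_mul_hermiteFn_mul (n k : ℕ) {g : ℝ → ℝ} (hg : PolyBounded g) :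
    Integrable (fun x => x ^ k * (hermiteFn n x * g x)) := by
  refine ((polyBounded_pow k).mul ((polyBounded_Hphys n).mul hg)).integrable_gaussian_mul.congr
    (Filter.Eventually.of_forall fun x => ?_)
  simp only [hermiteFn]
  ring

/-- The `k`-th moment `∫ x^k f(x) dx`. -/
noncomputable def mom (k : ℕ) (f : ℝ → ℝ) : ℝ := ∫ x, x ^ k * f x

/-- All moments of `f` exist. -/
def FiniteMom (f : ℝ → ℝ) : Prop := ∀ k : ℕ, Integrable (fun x => x ^ k * f x)

lemma integrable_and_mom_linear {f₁ f₂ f₃ f₄ : ℝ → ℝ} (h₁ : FiniteMom f₁) (h₂ : FiniteMom f₂)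
    (h₃ : FiniteMom f₃) (h₄ : FiniteMom f₄) (a b c d : ℝ) (k : ℕ) :
    Integrable (fun x => x ^ k * (a * (x * f₁ x) + b * f₂ x + c * f₃ x + d * f₄ x)) ∧
    mom k (fun x => a * (x * f₁ x) + b * f₂ x + c * f₃ x + d * f₄ x) =
      a * mom (k + 1) f₁ + b * mom k f₂ + c * mom k f₃ + d * mom k f₄ := by
  have e : (fun x => x ^ k * (a * (x * f₁ x) + b * f₂ x + c * f₃ x + d * f₄ x)) =
      fun x => a * (x ^ (k + 1) * f₁ x) + b * (x ^ k * f₂ x) + c * (x ^ k * f₃ x) +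
        d * (x ^ k * f₄ x) := by
    ext x; ring
  have i₁ := (h₁ (k + 1)).const_mul a
  have i₂ := (h₂ k).const_mul b
  have i₃ := (h₃ k).const_mul c
  have i₄ := (h₄ k).const_mul d
  have i₁₂ : Integrable (fun x => a * (x ^ (k + 1) * f₁ x) + b * (x ^ k * f₂ x)) := i₁.add i₂
  have i₁₂₃ : Integrable
      (fun x => a * (x ^ (k + 1) * f₁ x) + b * (x ^ k * f₂ x) + c * (x ^ k * f₃ x)) := i₁₂.add i₃
  refine ⟨by rw [e]; exact i₁₂₃.add i₄, ?_⟩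
  simp only [mom]
  rw [e, integral_add i₁₂₃ i₄, integral_add i₁₂ i₃, integral_add i₁ i₂]
  simp only [integral_const_mul]

/-- Integration by parts for moments. -/
lemma mom_by_parts {f f₁ f₂ f₃ : ℝ → ℝ} (hf : FiniteMom f) (h₁ : FiniteMom f₁)
    (h₂ : FiniteMom f₂) (h₃ : FiniteMom f₃) (a b c : ℝ)
    (hd : ∀ x, HasDerivAt f (a * (x * f₁ x) + b * f₂ x + c * f₃ x) x) (k : ℕ) :
    k * mom (k - 1) f + a * mom (k + 1) f₁ + b * mom k f₂ + c * mom k f₃ = 0 := by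
  obtain ⟨i, hi⟩ := integrable_and_mom_linear h₁ h₂ h₃ h₃ a b c 0 k
  have i' := (hf (k - 1)).const_mul k
  have h := integral_eq_zero_of_hasDerivAt_of_integrable
    (f := fun x => x ^ k * f x)
    (f' := fun x => (k : ℝ) * (x ^ (k - 1) * f x) +
      x ^ k * (a * (x * f₁ x) + b * f₂ x + c * f₃ x + 0 * f₃ x)) ?_ (i'.add i) (hf k)
  · rw [integral_add i' i, integral_const_mul] at h
    simp only [mom] at hi ⊢
    linarith
  · intro x
    refine ((hasDerivAt_pow k x).mul (hd x)).congr_deriv ?_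
    ring

section Relations

variable (m : ℕ)

lemma finiteMom_hermiteFn_mul_hermiteFn (i j : ℕ) :
    FiniteMom (fun x => hermiteFn i x * hermiteFn j x) :=
  fun k => integrable_pow_mul_hermiteFn_mul i k (polyBounded_hermiteFn j)

lemma finiteMom_hermiteFn_mul_Qfun (i j : ℕ) :
    FiniteMom (fun x => hermiteFn i x * Qfun j x) :=
  fun k => integrable_pow_mul_hermiteFn_mul i k (polyBounded_Qfun j)

/-- Moments of a product of two Hermite functions. -/
noncomputable def hermiteMom (i j k : ℕ) : ℝ := mom k (fun x => hermiteFn i x * hermiteFn j x)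

/-- Moments of a product of a Hermite function and an antiderivative of one. -/
noncomputable def hermiteQMom (i j k : ℕ) : ℝ := mom k (fun x => hermiteFn i x * Qfun j x)

lemma hermiteMom_rel_succ_succ (k : ℕ) :
    k * hermiteMom (m + 1) (m + 1) (k - 1) - 2 * hermiteMom (m + 1) (m + 1) (k + 1)
      + 4 * ((m : ℝ) + 1) * hermiteMom (m + 1) m k = 0 := by
  have h := mom_by_parts (finiteMom_hermiteFn_mul_hermiteFn (m + 1) (m + 1))
    (finiteMom_hermiteFn_mul_hermiteFn (m + 1) (m + 1))
    (finiteMom_hermiteFn_mul_hermiteFn (m + 1) m)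
    (finiteMom_hermiteFn_mul_hermiteFn (m + 1) m) (-2) (4 * ((m : ℝ) + 1)) 0
    (fun x => ((hasDerivAt_hermiteFn_down m x).mul (hasDerivAt_hermiteFn_down m x)).congr_deriv
      (by ring)) k
  simp only [hermiteMom]
  linarith

lemma hermiteMom_rel_succ_self (k : ℕ) :
    k * hermiteMom (m + 1) m (k - 1) - hermiteMom (m + 1) (m + 1) k
      + 2 * ((m : ℝ) + 1) * hermiteMom m m k = 0 := by
  have h := mom_by_parts (finiteMom_hermiteFn_mul_hermiteFn (m + 1) m)
    (finiteMom_hermiteFn_mul_hermiteFn m m)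
    (finiteMom_hermiteFn_mul_hermiteFn (m + 1) (m + 1))
    (finiteMom_hermiteFn_mul_hermiteFn m m) 0 (-1) (2 * ((m : ℝ) + 1))
    (fun x => ((hasDerivAt_hermiteFn_down m x).mul (hasDerivAt_hermiteFn_up m x)).congr_deriv
      (by ring)) k
  simp only [hermiteMom]
  linarith

lemma hermiteMom_rel_self_self (k : ℕ) :
    k * hermiteMom m m (k - 1) + 2 * hermiteMom m m (k + 1) - 2 * hermiteMom (m + 1) m k = 0 := by
  have h := mom_by_parts (finiteMom_hermiteFn_mul_hermiteFn m m)
    (finiteMom_hermiteFn_mul_hermiteFn m m)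
    (finiteMom_hermiteFn_mul_hermiteFn (m + 1) m)
    (finiteMom_hermiteFn_mul_hermiteFn m m) 2 (-2) 0
    (fun x => ((hasDerivAt_hermiteFn_up m x).mul (hasDerivAt_hermiteFn_up m x)).congr_deriv
      (by ring)) k
  simp only [hermiteMom]
  linarith

lemma hermiteQMom_rel_succ (k : ℕ) :
    k * hermiteQMom (m + 1) m (k - 1) - hermiteQMom (m + 1) m (k + 1)
      + 2 * ((m : ℝ) + 1) * hermiteQMom m m k + hermiteMom (m + 1) m k = 0 := by
  have h := mom_by_parts (finiteMom_hermiteFn_mul_Qfun (m + 1) m)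
    (finiteMom_hermiteFn_mul_Qfun (m + 1) m) (finiteMom_hermiteFn_mul_Qfun m m)
    (finiteMom_hermiteFn_mul_hermiteFn (m + 1) m) (-1) (2 * ((m : ℝ) + 1)) 1
    (fun x => ((hasDerivAt_hermiteFn_down m x).mul (hasDerivAt_Qfun m x)).congr_deriv
      (by ring)) k
  simp only [hermiteMom, hermiteQMom]
  linarith

lemma hermiteQMom_rel_self (k : ℕ) :
    k * hermiteQMom m m (k - 1) + hermiteQMom m m (k + 1) - hermiteQMom (m + 1) m k
      + hermiteMom m m k = 0 := by
  have h := mom_by_parts (finiteMom_hermiteFn_mul_Qfun m m)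
    (finiteMom_hermiteFn_mul_Qfun m m) (finiteMom_hermiteFn_mul_Qfun (m + 1) m)
    (finiteMom_hermiteFn_mul_hermiteFn m m) 1 (-1) 1
    (fun x => ((hasDerivAt_hermiteFn_up m x).mul (hasDerivAt_Qfun m x)).congr_deriv
      (by ring)) k
  simp only [hermiteMom, hermiteQMom]
  linarith

lemma hermiteMom_succ_self_even (q : ℕ) :
    2 * (q : ℝ) * hermiteMom (m + 1) m (2 * q - 1) =
      q * (2 * q - 1) * hermiteMom m m (2 * (q - 1)) + 2 * q * hermiteMom m m (2 * q) := by
  cases q with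
  | zero => simp
  | succ q =>
    have d := hermiteMom_rel_self_self m (2 * q + 1)
    simp only [Nat.add_sub_cancel, show 2 * (q + 1) = 2 * q + 1 + 1 by ring] at d ⊢
    push_cast at d ⊢
    linear_combination (-1 : ℝ) * ((q : ℝ) + 1) * d

/-- The Harer–Zagier type recurrence for the even moments of `φ_m²`. -/
lemma hermiteMom_recurrence (q : ℕ) :
    (2 * (q : ℝ) + 2) * hermiteMom m m (2 * (q + 1)) =
      (2 * q + 1) * (2 * (m + 1) - 1) * hermiteMom m m (2 * q)
        + (2 * q + 1) * (2 * q) * (2 * q - 1) / 4 * hermiteMom m m (2 * (q - 1)) := by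
  have a := hermiteMom_rel_succ_succ m (2 * q + 1)
  have b := hermiteMom_rel_succ_self m (2 * q)
  have b' := hermiteMom_rel_succ_self m (2 * q + 2)
  have c := hermiteMom_rel_self_self m (2 * q + 1)
  have d := hermiteMom_succ_self_even m q
  simp only [Nat.add_sub_cancel, show 2 * q + 2 - 1 = 2 * q + 1 by omega,
    show 2 * (q + 1) = 2 * q + 2 by ring, show 2 * q + 1 + 1 = 2 * q + 2 by ring] at *
  push_cast at *
  linear_combination (-1 / 2 : ℝ) * (a + (2 * (q : ℝ) + 1) * b - 2 * b'
    + (2 * ((m : ℝ) + 1) - (2 * q + 2)) * c - (2 * (q : ℝ) + 1) * d)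

lemma hermiteQMom_recurrence (q : ℕ) :
    hermiteQMom (m + 1) m (2 * (q + 2)) =
      (2 * ((m : ℝ) + 1) + 1) * hermiteQMom (m + 1) m (2 * (q + 1))
        + (2 * q + 2) * (2 * q + 1) * hermiteQMom (m + 1) m (2 * q)
        + ((2 * q + 3) / 2 * hermiteMom m m (2 * (q + 1)) + hermiteMom m m (2 * (q + 2)))
        - 2 * (m + 1) * hermiteMom m m (2 * (q + 1))
        + (2 * q + 2) * ((2 * q + 1) / 2 * hermiteMom m m (2 * q)
          + hermiteMom m m (2 * (q + 1))) := by
  have a := hermiteQMom_rel_succ m (2 * q + 3)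
  have a' := hermiteQMom_rel_succ m (2 * q + 1)
  have b := hermiteQMom_rel_self m (2 * q + 2)
  have c := hermiteMom_rel_self_self m (2 * q + 3)
  have c' := hermiteMom_rel_self_self m (2 * q + 1)
  simp only [Nat.add_sub_cancel, show 2 * q + 2 - 1 = 2 * q + 1 by omega,
    show 2 * q + 3 - 1 = 2 * q + 2 by omega,
    show 2 * (q + 1) = 2 * q + 2 by ring, show 2 * (q + 2) = 2 * q + 4 by ring,
    show 2 * q + 1 + 1 = 2 * q + 2 by ring, show 2 * q + 2 + 1 = 2 * q + 3 by ring,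
    show 2 * q + 3 + 1 = 2 * q + 4 by ring] at *
  push_cast at *
  linear_combination -a + 2 * ((m : ℝ) + 1) * b - (2 * (q : ℝ) + 2) * a' - (1 / 2 : ℝ) * c
    - ((q : ℝ) + 1) * c'

lemma hermiteMom_succ_zero :
    hermiteMom (m + 1) (m + 1) 0 = 2 * ((m : ℝ) + 1) * hermiteMom m m 0 := by
  have h := hermiteMom_rel_succ_self m 0
  simp only [Nat.cast_zero, zero_mul] at h
  linarith

/-- The `L²` norm of the Hermite functions. -/
lemma hermiteMom_self_zero : hermiteMom m m 0 = √Real.pi * 2 ^ m * (m ! : ℝ) := by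
  induction m with
  | zero =>
    have h := integral_gaussian 1
    simp only [div_one] at h
    simp only [hermiteMom, mom, hermiteFn, Hphys, pow_zero, Nat.factorial_zero, Nat.cast_one,
      mul_one, one_mul, ← h, ← Real.exp_add]
    congr 1 with x
    ring_nf
  | succ m ih =>
    rw [hermiteMom_succ_zero, ih, Nat.factorial_succ]
    push_cast
    ring

lemma hermiteQMom_add_two_zero :
    hermiteQMom (m + 2) (m + 1) 0 = 2 * ((m : ℝ) + 1) * hermiteQMom m (m + 1) 0
      + 2 * hermiteMom (m + 1) (m + 1) 0 := by
  have h := mom_by_parts (finiteMom_hermiteFn_mul_Qfun (m + 1) (m + 1))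
    (finiteMom_hermiteFn_mul_Qfun (m + 1) (m + 1)) (finiteMom_hermiteFn_mul_Qfun m (m + 1))
    (finiteMom_hermiteFn_mul_hermiteFn (m + 1) (m + 1)) (-1) (2 * ((m : ℝ) + 1)) 1
    (fun x => ((hasDerivAt_hermiteFn_down m x).mul (hasDerivAt_Qfun (m + 1) x)).congr_deriv
      (by ring)) 0
  have h' := hermiteQMom_rel_self (m + 1) 0
  simp only [hermiteMom, hermiteQMom, Nat.cast_zero, zero_mul] at h h' ⊢
  linarith

lemma hermiteQMom_odd_zero (j : ℕ) : hermiteQMom (2 * j + 2) (2 * j + 1) 0 = 0 := by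
  induction j with
  | zero =>
    have h : hermiteQMom 0 1 0 = -2 * hermiteMom 0 0 0 := by
      simp only [hermiteQMom, hermiteMom, mom, ← integral_const_mul, Qfun_one]
      congr 1 with x
      ring
    have h1 := hermiteQMom_add_two_zero 0
    have h2 := hermiteMom_succ_zero 0
    norm_num at h1 h2 ⊢
    rw [h1, h2, h]
    ring
  | succ j ih =>
    have hQ : hermiteQMom (2 * j + 2) (2 * j + 3) 0 =
        2 * (((2 * j + 1 : ℕ) : ℝ) + 1) * hermiteQMom (2 * j + 2) (2 * j + 1) 0
          - 2 * hermiteMom (2 * j + 2) (2 * j + 2) 0 := by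
      simp only [hermiteQMom, hermiteMom, mom, ← integral_const_mul]
      rw [← integral_sub ((finiteMom_hermiteFn_mul_Qfun _ _ 0).const_mul _)
        ((finiteMom_hermiteFn_mul_hermiteFn _ _ 0).const_mul _)]
      congr 1 with x
      rw [Qfun_add_two (2 * j + 1)]
      ring
    have h1 := hermiteQMom_add_two_zero (2 * j + 2)
    have h2 := hermiteMom_succ_zero (2 * j + 2)
    change hermiteQMom (2 * j + 2 + 2) (2 * j + 2 + 1) 0 = 0
    rw [h1, hQ, h2, ih]
    ring

end Relations

lemma gseDensity_succ_s18 (M : ℕ) (x : ℝ) :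
    gseDensity (M + 1) x = (Bconst (M + 1))⁻¹ *
      (-2 * (x * (hermiteFn (2 * M + 2) x * hermiteFn (2 * M + 1) x))
        + 2 * (((2 * M + 1 : ℕ) : ℝ) + 1) * (hermiteFn (2 * M + 1) x * hermiteFn (2 * M + 1) x)
        + 1 * (hermiteFn (2 * M + 2) x * hermiteFn (2 * M + 2) x)
        + 1 * (hermiteFn (2 * M + 2) x * Qfun (2 * M + 1) x)) := by
  have e : Real.exp (-x ^ 2) = Real.exp (-x ^ 2 / 2) * Real.exp (-x ^ 2 / 2) := by
    rw [← Real.exp_add]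
    ring_nf
  simp only [gseDensity, show 2 * (M + 1) = 2 * M + 1 + 1 by ring, Nat.add_sub_cancel]
  rw [((hasDerivAt_Hphys (2 * M + 1)).1 x).deriv, ((hasDerivAt_Hphys (2 * M + 1)).2 x).deriv, e]
  simp only [hermiteFn]
  ring

lemma gseMoment_succ (M q : ℕ) :
    gseMoment (M + 1) q = (Bconst (M + 1))⁻¹ *
      (hermiteQMom (2 * M + 2) (2 * M + 1) (2 * q)
        - 2 * hermiteMom (2 * M + 1) (2 * M + 1) (2 * (q + 1))
        + (4 * (2 * (M + 1)) - 1) * hermiteMom (2 * M + 1) (2 * M + 1) (2 * q)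
        + 2 * q * (2 * q - 1) / 2 * hermiteMom (2 * M + 1) (2 * M + 1) (2 * (q - 1))) := by
  have h := (integrable_and_mom_linear
    (finiteMom_hermiteFn_mul_hermiteFn (2 * M + 2) (2 * M + 1))
    (finiteMom_hermiteFn_mul_hermiteFn (2 * M + 1) (2 * M + 1))
    (finiteMom_hermiteFn_mul_hermiteFn (2 * M + 2) (2 * M + 2))
    (finiteMom_hermiteFn_mul_Qfun (2 * M + 2) (2 * M + 1)) (-2)
    (2 * (((2 * M + 1 : ℕ) : ℝ) + 1)) 1 1 (2 * q)).2
  have a := hermiteMom_rel_succ_self (2 * M + 1) (2 * q)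
  have b := hermiteMom_rel_self_self (2 * M + 1) (2 * q + 1)
  have c := hermiteMom_succ_self_even (2 * M + 1) q
  have g : gseMoment (M + 1) q = (Bconst (M + 1))⁻¹ * mom (2 * q) (fun x =>
      -2 * (x * (hermiteFn (2 * M + 2) x * hermiteFn (2 * M + 1) x))
        + 2 * (((2 * M + 1 : ℕ) : ℝ) + 1) * (hermiteFn (2 * M + 1) x * hermiteFn (2 * M + 1) x)
        + 1 * (hermiteFn (2 * M + 2) x * hermiteFn (2 * M + 2) x)
        + 1 * (hermiteFn (2 * M + 2) x * Qfun (2 * M + 1) x)) := by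
    rw [mom, ← integral_const_mul, gseMoment]
    congr 1 with x
    rw [gseDensity_succ_s18, mul_left_comm]
  rw [g, h]
  congr 1
  simp only [Nat.add_sub_cancel, show 2 * M + 1 + 1 = 2 * M + 2 by ring,
    show 2 * (q + 1) = 2 * q + 1 + 1 by ring, hermiteMom, hermiteQMom] at *
  push_cast at *
  linear_combination -a + b + c

/-- Elimination: the second order recurrences for `φ_m²` and `φ_{m+1} Q_m` imply Ledoux's
five-term recurrence. -/
lemma five_term_of_recurrences (c d μ : ℕ → ℝ) (n b : ℝ)
    (hc : ∀ q : ℕ, (2 * (q : ℝ) + 2) * c (q + 1) =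
      (2 * q + 1) * (2 * n - 1) * c q + (2 * q + 1) * (2 * q) * (2 * q - 1) / 4 * c (q - 1))
    (hd : ∀ q : ℕ, d (q + 2) = (2 * n + 1) * d (q + 1) + (2 * q + 2) * (2 * q + 1) * d q
      + ((2 * q + 3) / 2 * c (q + 1) + c (q + 2)) - 2 * n * c (q + 1)
      + (2 * q + 2) * ((2 * q + 1) / 2 * c q + c (q + 1)))
    (hμ : ∀ q : ℕ, μ q = b * (d q - 2 * c (q + 1) + (4 * n - 1) * c q
      + 2 * q * (2 * q - 1) / 2 * c (q - 1))) (q : ℕ) :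
    ((q : ℝ) + 4 + 1) * μ (q + 4) =
      (1 / 2) * (4 * ((q : ℝ) + 4) - 1) * (2 * n + 1) * μ (q + 3) +
        (1 / 4) * (2 * ((q : ℝ) + 4) - 3) *
          (10 * ((q : ℝ) + 4) ^ 2 - 9 * ((q : ℝ) + 4) - 8 * n ^ 2 - 8 * n) * μ (q + 2) -
        (5 / 8) * (2 * ((q : ℝ) + 4) - 3) * (2 * ((q : ℝ) + 4) - 4) * (2 * ((q : ℝ) + 4) - 5) *
          (2 * n + 1) * μ (q + 1) -
        (1 / 8) * (2 * ((q : ℝ) + 4) - 3) * (2 * ((q : ℝ) + 4) - 4) * (2 * ((q : ℝ) + 4) - 5) *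
          (2 * ((q : ℝ) + 4) - 6) * (2 * ((q : ℝ) + 4) - 7) * μ q := by
  have hc' : ∀ q : ℕ, c (q + 1) = ((2 * q + 1) * (2 * n - 1) * c q
      + (2 * q + 1) * (2 * q) * (2 * q - 1) / 4 * c (q - 1)) / (2 * q + 2) := fun q =>
    eq_div_of_mul_eq (by positivity) ((mul_comm _ _).trans (hc q))
  have c1 := hc' q
  have c2 := hc' (q + 1)
  have c3 := hc' (q + 2)
  have c4 := hc' (q + 3)
  have c5 := hc' (q + 4)
  have d2 := hd q
  have d3 := hd (q + 1)
  have d4 := hd (q + 2)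
  rw [hμ, hμ, hμ, hμ, hμ]
  simp only [add_assoc, Nat.reduceAdd, Nat.add_sub_cancel, Nat.add_succ_sub_one] at *
  rw [d4, d3, d2, c5, c4, c3, c2, c1]
  push_cast
  field_simp
  ring

/-- The even GSE moments satisfy `m_0 = N`, `m_2 = N(N−1/2)`, and Ledoux's
five-term recurrence. -/
theorem gseMoment_recurrence (N : ℕ) (hN : 1 ≤ N) :
    gseMoment N 0 = N ∧ gseMoment N 1 = (N : ℝ) * ((N : ℝ) - 1 / 2) ∧
    ∀ p : ℕ, 4 ≤ p →
      ((p : ℝ) + 1) * gseMoment N p =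
        (1 / 2) * (4 * (p : ℝ) - 1) * (4 * (N : ℝ) + 1) * gseMoment N (p - 1) +
          (1 / 4) * (2 * (p : ℝ) - 3) *
            (10 * (p : ℝ) ^ 2 - 9 * (p : ℝ) - 32 * (N : ℝ) ^ 2 - 16 * (N : ℝ)) *
            gseMoment N (p - 2) -
          (5 / 8) * (2 * (p : ℝ) - 3) * (2 * (p : ℝ) - 4) * (2 * (p : ℝ) - 5) *
            (4 * (N : ℝ) + 1) * gseMoment N (p - 3) -
          (1 / 8) * (2 * (p : ℝ) - 3) * (2 * (p : ℝ) - 4) * (2 * (p : ℝ) - 5) *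
            (2 * (p : ℝ) - 6) * (2 * (p : ℝ) - 7) * gseMoment N (p - 4) := by
  obtain ⟨M, rfl⟩ : ∃ M, N = M + 1 := ⟨N - 1, by omega⟩
  have hB : Bconst (M + 1) = 4 * hermiteMom (2 * M + 1) (2 * M + 1) 0 := by
    rw [hermiteMom_self_zero, Bconst, show 2 * (M + 1) - 1 = 2 * M + 1 by omega]
    ring
  have hC : hermiteMom (2 * M + 1) (2 * M + 1) 0 ≠ 0 := by
    rw [hermiteMom_self_zero]
    positivity
  have hD := hermiteQMom_odd_zero M
  have c1 := hermiteMom_recurrence (2 * M + 1) 0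
  have c2 := hermiteMom_recurrence (2 * M + 1) 1
  refine ⟨?_, ?_, fun p hp => ?_⟩
  · rw [gseMoment_succ, hB]
    norm_num [hD] at c1 ⊢
    field_simp
    linear_combination (-1 : ℝ) * c1
  · have d := hermiteQMom_rel_succ (2 * M + 1) 1
    have e := hermiteQMom_rel_self (2 * M + 1) 0
    have b := hermiteMom_rel_self_self (2 * M + 1) 1
    rw [gseMoment_succ, hB]
    norm_num [hD] at c1 c2 b d e ⊢
    field_simp
    linear_combination (-2 : ℝ) * d + 8 * ((M : ℝ) + 1) * e - b - c2 + (4 * (M : ℝ) + 7) / 2 * c1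
  · obtain ⟨q, rfl⟩ := Nat.exists_eq_add_of_le' hp
    have h := five_term_of_recurrences (fun j => hermiteMom (2 * M + 1) (2 * M + 1) (2 * j))
      (fun j => hermiteQMom (2 * M + 2) (2 * M + 1) (2 * j)) (gseMoment (M + 1))
      (((2 * M + 1 : ℕ) : ℝ) + 1) (Bconst (M + 1))⁻¹ (hermiteMom_recurrence (2 * M + 1))
      (hermiteQMom_recurrence (2 * M + 1))
      (fun q => by rw [gseMoment_succ]; push_cast; ring) q
    simp only [Nat.add_sub_cancel, show q + 4 - 1 = q + 3 by omega,
      show q + 4 - 2 = q + 2 by omega, show q + 4 - 3 = q + 1 by omega]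
    push_cast at h ⊢
    linear_combination h
end
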